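/- arXiv:1404.4155 — 7 statements merged into one kernel-verified Lean document; each statement's English description precedes it below -/
import Mathlib

section
/- Let f = h + conj(g) be a harmonic mapping of the unit disk 𝔻 into ℂ (h, g holomorphic on 𝔻, g(0) = 0) such that |f(z)| ≤ M for all z ∈ 𝔻, where M > 0. Then for every integer n ≥ 1 and every z ∈ 𝔻, |h^(n)(z)| + |g^(n)(z)| ≤ (4M·n!/π) · 1/((1 − |z|)^n · (1 + |z|)). -/
open Complex Metric Set ComplexConjugate

/-- The integral of `|cos|` over `k ≥ 1` full turns, rescaled to one turn, is `4`. -/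
lemma integral_abs_cos_natCast_mul_add (k : ℕ) (hk : 1 ≤ k) (a : ℝ) :
    ∫ θ in (0 : ℝ)..2 * Real.pi, |Real.cos (k * θ + a)| = 4 := by
  have hk0 : (k : ℝ) ≠ 0 := by positivity
  have hper : Function.Periodic (fun x : ℝ => |Real.cos x|) Real.pi := fun x => by
    simp [Real.cos_add_pi]
  have hint : ∀ t₁ t₂ : ℝ, IntervalIntegrable (fun x : ℝ => |Real.cos x|)
      MeasureTheory.MeasureSpace.volume t₁ t₂ := fun t₁ t₂ =>
    (Real.continuous_cos.abs).intervalIntegrable _ _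
  have hone : ∫ x in a..a + Real.pi, |Real.cos x| = 2 := by
    rw [hper.intervalIntegral_add_eq a (-(Real.pi / 2))]
    have hcongr : ∫ x in (-(Real.pi / 2))..(-(Real.pi / 2) + Real.pi), |Real.cos x|
        = ∫ x in (-(Real.pi / 2))..(-(Real.pi / 2) + Real.pi), Real.cos x := by
      refine intervalIntegral.integral_congr fun x hx => ?_
      rw [uIcc_of_le (by linarith [Real.pi_pos])] at hx
      exact abs_of_nonneg (Real.cos_nonneg_of_mem_Icc ⟨hx.1, by linarith [hx.2]⟩)
    rw [hcongr, integral_cos, show -(Real.pi / 2) + Real.pi = Real.pi / 2 by ring]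
    norm_num
  have hall := hper.intervalIntegral_add_zsmul_eq (2 * k : ℤ) a hint
  rw [hone] at hall
  rw [intervalIntegral.integral_comp_mul_add (fun x => |Real.cos x|) hk0 a,
    show (k : ℝ) * 0 + a = a by ring,
    show (k : ℝ) * (2 * Real.pi) + a = a + (2 * k : ℤ) • Real.pi by
      push_cast [zsmul_eq_mul]; ring, hall]
  push_cast [zsmul_eq_mul, smul_eq_mul]
  field_simp
  norm_num

/-- Coefficient estimate on a circle for a holomorphic function with bounded real part. -/
lemma norm_iteratedDeriv_mul_pow_le_of_abs_re_le {G : ℂ → ℂ} {M r : ℝ} (hr : 0 < r)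
    (hG : DifferentiableOn ℂ G (closedBall 0 r))
    (hM : ∀ w ∈ sphere (0 : ℂ) r, |(G w).re| ≤ M) {k : ℕ} (hk : 1 ≤ k) :
    ‖iteratedDeriv k G 0‖ * r ^ k ≤ 4 * M / Real.pi * k.factorial := by
  set c := iteratedDeriv k G 0
  set α := c.arg with hα
  have hcont : Continuous fun θ : ℝ => G (circleMap 0 r θ) :=
    hG.continuousOn.comp_continuous (continuous_circleMap 0 r)
      fun θ => sphere_subset_closedBall (circleMap_mem_sphere 0 hr.le θ)
  have hrC : (r : ℂ) ≠ 0 := by exact_mod_cast hr.ne'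
  have hneg : ∫ θ in (0 : ℝ)..2 * Real.pi, G (circleMap 0 r θ) * exp (-(k * θ * I))
      = 2 * Real.pi * c / k.factorial * r ^ k := by
    have h1 := hG.circleIntegral_one_div_sub_center_pow_smul hr k
    simp only [circleIntegral, deriv_circleMap, sub_zero, smul_eq_mul] at h1
    have h2 : ∀ θ : ℝ, circleMap 0 r θ * I *
        (1 / circleMap 0 r θ ^ (k + 1) * G (circleMap 0 r θ)) =
        I / r ^ k * (G (circleMap 0 r θ) * exp (-(k * θ * I))) := fun θ => by
      have h0 : circleMap 0 r θ ≠ 0 := circleMap_ne_center hr.ne'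
      have h3 : circleMap 0 r θ ^ k * exp (-(k * θ * I)) = r ^ k := by
        rw [circleMap_zero, mul_pow, ← exp_nat_mul, mul_assoc, ← exp_add]
        simp [mul_assoc]
      rw [← h3]
      have h4 := exp_ne_zero (-(k * θ * I))
      field_simp
      ring
    simp only [h2, intervalIntegral.integral_const_mul] at h1
    rw [div_mul_eq_mul_div, div_eq_iff (pow_ne_zero _ hrC)] at h1
    apply mul_left_cancel₀ I_ne_zero
    rw [h1]
    ring
  have hpos : ∫ θ in (0 : ℝ)..2 * Real.pi, G (circleMap 0 r θ) * exp (k * θ * I) = 0 := by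
    have h1 := DiffContOnCl.circleIntegral_eq_zero hr.le
      (((hG.mul ((differentiable_id.pow (k - 1)).differentiableOn)).mono
        closure_ball_subset_closedBall).diffContOnCl)
    simp only [circleIntegral, deriv_circleMap, smul_eq_mul, Pi.mul_apply, Pi.pow_apply,
      id] at h1
    have h2 : ∀ θ : ℝ, circleMap 0 r θ * I * (G (circleMap 0 r θ) * circleMap 0 r θ ^ (k - 1)) =
        I * r ^ k * (G (circleMap 0 r θ) * exp (k * θ * I)) := fun θ => by
      have h3 : circleMap 0 r θ ^ (k - 1) * circleMap 0 r θ = r ^ k * exp (k * θ * I) := by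
        rw [← pow_succ, Nat.sub_add_cancel hk, circleMap_zero, mul_pow, ← exp_nat_mul, mul_assoc]
      linear_combination I * G (circleMap 0 r θ) * h3
    simp only [h2, intervalIntegral.integral_const_mul] at h1
    exact (mul_eq_zero.1 h1).resolve_left (mul_ne_zero I_ne_zero (pow_ne_zero _ hrC))
  have hcos : ∀ θ : ℝ, G (circleMap 0 r θ) * (2 * Real.cos (k * θ + α) : ℝ) =
      exp (-(α * I)) * (G (circleMap 0 r θ) * exp (-(k * θ * I))) +
      exp (α * I) * (G (circleMap 0 r θ) * exp (k * θ * I)) := fun θ => by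
    have h1 : ((2 * Real.cos (k * θ + α) : ℝ) : ℂ) =
        exp (α * I) * exp (k * θ * I) + exp (-(α * I)) * exp (-(k * θ * I)) := by
      push_cast
      rw [two_cos, ← exp_add, ← exp_add]
      ring_nf
    rw [h1]
    ring
  have hsum : ∫ θ in (0 : ℝ)..2 * Real.pi, G (circleMap 0 r θ) * (2 * Real.cos (k * θ + α) : ℝ)
      = ((2 * Real.pi * ‖c‖ / k.factorial * r ^ k : ℝ) : ℂ) := by
    simp only [hcos]
    rw [intervalIntegral.integral_add, intervalIntegral.integral_const_mul,
      intervalIntegral.integral_const_mul, hneg, hpos]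
    · have h1 : exp (-(α * I)) * c = ‖c‖ := by
        conv_lhs => rw [← norm_mul_exp_arg_mul_I c]
        rw [mul_left_comm, ← exp_add, ← hα]
        simp
      push_cast
      rw [← h1]
      ring
    · exact (continuous_const.mul (hcont.mul (by fun_prop))).intervalIntegrable _ _
    · exact (continuous_const.mul (hcont.mul (by fun_prop))).intervalIntegrable _ _
  have hre : ∫ θ in (0 : ℝ)..2 * Real.pi, (G (circleMap 0 r θ)).re * (2 * Real.cos (k * θ + α))
      = 2 * Real.pi * ‖c‖ / k.factorial * r ^ k := by
    have h1 := congrArg Complex.re hsum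
    rw [ofReal_re] at h1
    rw [← h1]
    have h2 := reCLM.intervalIntegral_comp_comm (μ := MeasureTheory.volume) (a := 0)
      (b := 2 * Real.pi)
      (f := fun θ : ℝ => G (circleMap 0 r θ) * (2 * Real.cos (k * θ + α) : ℝ))
      ((hcont.mul (by fun_prop)).intervalIntegrable _ _)
    simpa only [reCLM_apply, re_mul_ofReal] using h2
  have hle : ∫ θ in (0 : ℝ)..2 * Real.pi, (G (circleMap 0 r θ)).re * (2 * Real.cos (k * θ + α))
      ≤ ∫ θ in (0 : ℝ)..2 * Real.pi, 2 * M * |Real.cos (k * θ + α)| := by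
    apply intervalIntegral.integral_mono_on Real.two_pi_pos.le
    · exact ((continuous_re.comp hcont).mul (by fun_prop)).intervalIntegrable _ _
    · exact (by fun_prop : Continuous _).intervalIntegrable _ _
    · intro θ _
      have h1 := hM _ (circleMap_mem_sphere 0 hr.le θ)
      calc _ ≤ |(G (circleMap 0 r θ)).re * (2 * Real.cos (k * θ + α))| := le_abs_self _
        _ = 2 * (|(G (circleMap 0 r θ)).re| * |Real.cos (k * θ + α)|) := by
          rw [abs_mul, abs_mul, abs_two]; ring
        _ ≤ 2 * (M * |Real.cos (k * θ + α)|) := by gcongr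
        _ = _ := by ring
  rw [hre, intervalIntegral.integral_const_mul, integral_abs_cos_natCast_mul_add k hk] at hle
  have hfac : (0 : ℝ) < k.factorial := by positivity
  rw [div_mul_eq_mul_div, div_le_iff₀ hfac] at hle
  rw [div_mul_eq_mul_div, le_div_iff₀ Real.pi_pos]
  linarith

/-- A holomorphic function on the unit disk with `|Re G| ≤ M` has Taylor coefficients of positive
order bounded by `4 * M / π`. -/
lemma norm_iteratedDeriv_zero_le_of_abs_re_le {G : ℂ → ℂ} {M : ℝ}
    (hG : DifferentiableOn ℂ G (ball 0 1)) (hM : ∀ w ∈ ball (0 : ℂ) 1, |(G w).re| ≤ M)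
    {k : ℕ} (hk : 1 ≤ k) :
    ‖iteratedDeriv k G 0‖ ≤ 4 * M / Real.pi * k.factorial := by
  have hlim : Filter.Tendsto (fun r : ℝ => ‖iteratedDeriv k G 0‖ * r ^ k)
      (nhdsWithin 1 (Iio 1)) (nhds ‖iteratedDeriv k G 0‖) := by
    have h1 : Continuous fun r : ℝ => ‖iteratedDeriv k G 0‖ * r ^ k := by fun_prop
    simpa using (h1.tendsto 1).mono_left nhdsWithin_le_nhds
  refine le_of_tendsto hlim ?_
  filter_upwards [Ioo_mem_nhdsLT (zero_lt_one' ℝ)] with r hr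
  have hsub := closedBall_subset_ball (x := (0 : ℂ)) hr.2
  exact norm_iteratedDeriv_mul_pow_le_of_abs_re_le hr.1 (hG.mono hsub)
    (fun w hw => hM w (hsub (sphere_subset_closedBall hw))) hk

/-- The recurrence satisfied by the Lah numbers `(m + 1)! / (j + 1)! * choose m j`. -/
lemma lah_recurrence (m j : ℕ) :
    ((m + 2).factorial / (j + 2).factorial * (m + 1).choose (j + 1) : ℂ) =
      (m + 1).factorial / (j + 1).factorial * m.choose j +
        (m + j + 3) * ((m + 1).factorial / (j + 2).factorial * m.choose (j + 1)) := by
  have h1 : (m.choose (j + 1) * (j + 1) : ℂ) = m.choose j * (m - j) := by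
    rcases le_or_gt j m with h | h
    · have := Nat.choose_succ_right_eq m j
      rw [← Nat.cast_sub h]
      exact_mod_cast this
    · simp [Nat.choose_eq_zero_of_lt h, Nat.choose_eq_zero_of_lt (h.trans (Nat.lt_succ_self j))]
  have h2 : ((j + 1).factorial : ℂ) ≠ 0 := by exact_mod_cast Nat.factorial_ne_zero _
  have h3 : ((j : ℂ) + 2) ≠ 0 := by exact_mod_cast (Nat.succ_ne_zero (j + 1))
  rw [Nat.choose_succ_succ, Nat.factorial_succ (m + 1), Nat.factorial_succ (j + 1)]
  push_cast
  rw [show (j : ℂ) + 1 + 1 = j + 2 by ring]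
  field_simp
  linear_combination -((m + 1).factorial : ℂ) * h1

/-- Higher derivatives of `G ∘ ψ`, where `ψ` has the derivative of a Möbius transformation. -/
lemma iteratedDeriv_comp_mobius {G ψ : ℂ → ℂ} {U V : Set ℂ} {a D : ℂ} (hU : IsOpen U)
    (hV : IsOpen V) (hG : DifferentiableOn ℂ G V) (hmaps : MapsTo ψ U V)
    (hne : ∀ u ∈ U, 1 - a * u ≠ 0)
    (hψ : ∀ u ∈ U, HasDerivAt ψ (D / (1 - a * u) ^ 2) u) (m : ℕ) :
    ∀ u ∈ U, iteratedDeriv (m + 1) (fun u => G (ψ u)) u =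
      ∑ j ∈ Finset.range (m + 1), ((m + 1).factorial / (j + 1).factorial * m.choose j : ℂ) *
        (iteratedDeriv (j + 1) G (ψ u) * (a ^ (m - j) * D ^ (j + 1) *
          ((1 - a * u)⁻¹) ^ (m + j + 2))) := by
  have hGn : ∀ n, ∀ v ∈ V, HasDerivAt (iteratedDeriv n G) (iteratedDeriv (n + 1) G v) v := by
    intro n v hv
    rw [iteratedDeriv_succ]
    have han : AnalyticAt ℂ G v := hG.analyticAt (hV.mem_nhds hv)
    rw [iteratedDeriv_eq_iterate]
    exact (han.iterated_deriv n).differentiableAt.hasDerivAt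
  induction m with
  | zero =>
    intro u hu
    have h1 := (hGn 0 (ψ u) (hmaps hu)).comp u (hψ u hu)
    simp only [iteratedDeriv_zero] at h1
    rw [iteratedDeriv_one, show (fun u => G (ψ u)) = G ∘ ψ from rfl, h1.deriv]
    simp [div_eq_mul_inv]
  | succ m ih =>
    intro u hu
    rw [iteratedDeriv_succ, (Filter.eventuallyEq_of_mem (hU.mem_nhds hu) ih).deriv_eq]
    set q := (1 - a * u)⁻¹ with hq
    have hinv : ∀ n : ℕ, HasDerivAt (fun u : ℂ => ((1 - a * u)⁻¹) ^ n) (n * a * q ^ (n + 1)) u := by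
      intro n
      have h1 : HasDerivAt (fun u : ℂ => 1 - a * u) (-a) u := by
        simpa using ((hasDerivAt_id u).const_mul a).const_sub 1
      have h2 := (h1.inv (hne u hu)).pow n
      refine h2.congr_deriv ?_
      rcases n with _ | n
      · simp
      · simp only [Pi.inv_apply, Nat.add_sub_cancel, div_eq_mul_inv, ← inv_pow, ← hq]
        ring
    have hterm : ∀ j ∈ Finset.range (m + 1), HasDerivAt
        (fun u => ((m + 1).factorial / (j + 1).factorial * m.choose j : ℂ) *
          (iteratedDeriv (j + 1) G (ψ u) * (a ^ (m - j) * D ^ (j + 1) *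
            ((1 - a * u)⁻¹) ^ (m + j + 2))))
        (((m + 1).factorial / (j + 1).factorial * m.choose j : ℂ) *
          (iteratedDeriv (j + 2) G (ψ u) * (a ^ (m - j) * D ^ (j + 2) * q ^ (m + j + 4))) +
        ((m + j + 2) * ((m + 1).factorial / (j + 1).factorial * m.choose j) : ℂ) *
          (iteratedDeriv (j + 1) G (ψ u) * (a ^ (m + 1 - j) * D ^ (j + 1) * q ^ (m + j + 3)))) u := by
      intro j hj
      have hjm : m + 1 - j = m - j + 1 := by
        have := Finset.mem_range.1 hj
        omega
      have h1 := (hGn (j + 1) (ψ u) (hmaps hu)).comp u (hψ u hu)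
      have h2 := (h1.mul ((hinv (m + j + 2)).const_mul (a ^ (m - j) * D ^ (j + 1)))).const_mul
        ((m + 1).factorial / (j + 1).factorial * m.choose j : ℂ)
      refine h2.congr_deriv ?_
      simp only [Function.comp_apply, hjm, div_eq_mul_inv (D : ℂ), ← inv_pow, ← hq]
      push_cast
      ring
    rw [(HasDerivAt.fun_sum hterm).deriv, Finset.sum_add_distrib]
    rw [Finset.sum_range_succ' (fun j => (((m + 1 + 1).factorial / (j + 1).factorial *
      (m + 1).choose j : ℂ)) * _) (m + 1)]
    simp only [show ∀ j, j + 1 + 1 = j + 2 from fun _ => rfl, lah_recurrence, add_mul (_ / _ * _ : ℂ) _ _,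
      Finset.sum_add_distrib]
    rw [add_assoc]
    congr 1
    · refine Finset.sum_congr rfl fun j _ => ?_
      rw [Nat.add_sub_add_right]
      ring
    · rw [Finset.sum_range_succ' _ m,
        Finset.sum_range_succ (fun j => (m + j + 3 : ℂ) * _ * _) m]
      simp only [Nat.choose_succ_self, Nat.cast_zero, mul_zero, zero_mul, add_zero]
      congr 1
      · refine Finset.sum_congr rfl fun j _ => ?_
        rw [Nat.add_sub_add_right]
        push_cast
        ring
      · rw [Nat.factorial_succ (m + 1)]
        simp only [zero_add, Nat.factorial_one, Nat.choose_zero_right, Nat.cast_one]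
        push_cast
        ring

/-- The disk automorphism `w ↦ (w + z) / (1 + conj z * w)` is well defined and maps the unit disk
into itself. -/
lemma mobius_mem_ball {z w : ℂ} (hz : z ∈ ball (0 : ℂ) 1) (hw : w ∈ ball (0 : ℂ) 1) :
    1 + conj z * w ≠ 0 ∧ (w + z) / (1 + conj z * w) ∈ ball (0 : ℂ) 1 := by
  rw [mem_ball_zero_iff] at hz hw
  have hlt : ‖w + z‖ < ‖1 + conj z * w‖ := by
    have h1 : 0 < (1 - ‖z‖ ^ 2) * (1 - ‖w‖ ^ 2) :=
      mul_pos (by nlinarith [norm_nonneg z]) (by nlinarith [norm_nonneg w])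
    have h2 : ‖1 + conj z * w‖ ^ 2 - ‖w + z‖ ^ 2 = (1 - ‖z‖ ^ 2) * (1 - ‖w‖ ^ 2) := by
      simp only [Complex.sq_norm, normSq_apply, add_re, add_im, mul_re, mul_im, conj_re, conj_im,
        one_re, one_im]
      ring
    exact lt_of_pow_lt_pow_left₀ 2 (norm_nonneg _) (by linarith)
  have hpos : 0 < ‖1 + conj z * w‖ := (norm_nonneg _).trans_lt hlt
  refine ⟨norm_pos_iff.1 hpos, ?_⟩
  rw [mem_ball_zero_iff, norm_div, div_lt_one hpos]
  exact hlt

/-- Higher-order Schwarz–Pick estimate for a holomorphic function with bounded real part. -/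
lemma norm_iteratedDeriv_le_of_abs_re_le {F : ℂ → ℂ} {M : ℝ}
    (hF : DifferentiableOn ℂ F (ball 0 1)) (hM : ∀ w ∈ ball (0 : ℂ) 1, |(F w).re| ≤ M)
    {n : ℕ} (hn : 1 ≤ n) {z : ℂ} (hz : z ∈ ball (0 : ℂ) 1) :
    ‖iteratedDeriv n F z‖ ≤
      4 * M * n.factorial / (Real.pi * (1 - ‖z‖) ^ n * (1 + ‖z‖)) := by
  obtain ⟨m, rfl⟩ : ∃ m, n = m + 1 := ⟨n - 1, by omega⟩
  have hz1 : ‖z‖ < 1 := mem_ball_zero_iff.1 hz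
  set D : ℂ := 1 - conj z * z with hD
  set φ : ℂ → ℂ := fun w => (w + z) / (1 + conj z * w) with hφ
  set ψ : ℂ → ℂ := fun u => (u - z) / (1 - conj z * u) with hψ
  have hφmem : ∀ w ∈ ball (0 : ℂ) 1, 1 + conj z * w ≠ 0 ∧ φ w ∈ ball (0 : ℂ) 1 :=
    fun w hw => mobius_mem_ball hz hw
  have hψmem : ∀ u ∈ ball (0 : ℂ) 1, 1 - conj z * u ≠ 0 ∧ ψ u ∈ ball (0 : ℂ) 1 := fun u hu => by
    have hz' : -z ∈ ball (0 : ℂ) 1 := by simpa using hz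
    simpa [hψ, sub_eq_add_neg] using mobius_mem_ball hz' hu
  have hDnorm : ‖D‖ = (1 - ‖z‖) * (1 + ‖z‖) := by
    have h1 : D = ((1 - ‖z‖ ^ 2 : ℝ) : ℂ) := by
      rw [hD, conj_mul']
      push_cast
      ring
    rw [h1, norm_real, Real.norm_of_nonneg (by nlinarith [norm_nonneg z])]
    ring
  have hD0 : D ≠ 0 := (hψmem z hz).1
  have hψderiv : ∀ u ∈ ball (0 : ℂ) 1, HasDerivAt ψ (D / (1 - conj z * u) ^ 2) u := by
    intro u hu
    have h1 : HasDerivAt (fun u : ℂ => 1 - conj z * u) (-conj z) u := by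
      simpa using ((hasDerivAt_id u).const_mul (conj z)).const_sub 1
    refine (((hasDerivAt_id u).sub_const z).div h1 (hψmem u hu).1).congr_deriv ?_
    simp only [id, hD]
    ring
  have hinv : EqOn F (fun u => F (φ (ψ u))) (ball 0 1) := by
    intro u hu
    have h1 := (hψmem u hu).1
    have h2 : φ (ψ u) = u := by
      have h3 := (hφmem _ (hψmem u hu).2).1
      simp only [hφ]
      rw [div_eq_iff h3]
      have h4 : ψ u * (1 - conj z * u) = u - z := div_mul_cancel₀ _ h1
      linear_combination h4
    simp only [h2]
  have hG : DifferentiableOn ℂ (fun w => F (φ w)) (ball 0 1) := by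
    refine hF.comp (fun w hw => ?_) fun w hw => (hφmem w hw).2
    have h1 := (hφmem w hw).1
    simp only [hφ]
    fun_prop (disch := assumption)
  have hcoef : ∀ k, 1 ≤ k → ‖iteratedDeriv k (fun w => F (φ w)) 0‖ ≤
      4 * M / Real.pi * k.factorial := fun k hk =>
    norm_iteratedDeriv_zero_le_of_abs_re_le hG (fun w hw => hM _ (hφmem w hw).2) hk
  have hψz : ψ z = 0 := by simp [hψ]
  rw [hinv.iteratedDeriv_of_isOpen isOpen_ball (m + 1) hz,
    iteratedDeriv_comp_mobius isOpen_ball isOpen_ball hG (fun u hu => (hψmem u hu).2)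
      (fun u hu => (hψmem u hu).1) hψderiv m z hz, hψz, ← hD]
  have hDpos : 0 < ‖D‖ := norm_pos_iff.2 hD0
  have hterm : ∀ j ∈ Finset.range (m + 1),
      ‖((m + 1).factorial / (j + 1).factorial * m.choose j : ℂ) *
        (iteratedDeriv (j + 1) (fun w => F (φ w)) 0 * (conj z ^ (m - j) * D ^ (j + 1) *
          (D⁻¹) ^ (m + j + 2)))‖ ≤
      4 * M / Real.pi * (m + 1).factorial / ‖D‖ ^ (m + 1) *
        (1 ^ j * ‖z‖ ^ (m - j) * m.choose j) := by
    intro j _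
    have hfac : (0 : ℝ) < (j + 1).factorial := by positivity
    simp only [norm_mul, norm_div, norm_pow, norm_inv, Complex.norm_natCast, RCLike.norm_conj]
    calc _ = (m + 1).factorial / (j + 1).factorial * m.choose j * ‖z‖ ^ (m - j) / ‖D‖ ^ (m + 1) *
          ‖iteratedDeriv (j + 1) (fun w => F (φ w)) 0‖ := by
          rw [show m + j + 2 = (m + 1) + (j + 1) by ring, inv_pow, pow_add _ (m + 1)]
          field_simp
      _ ≤ (m + 1).factorial / (j + 1).factorial * m.choose j * ‖z‖ ^ (m - j) / ‖D‖ ^ (m + 1) *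
          (4 * M / Real.pi * (j + 1).factorial) := by
          gcongr
          exact hcoef (j + 1) (by omega)
      _ = _ := by
          field_simp
          ring
  refine (norm_sum_le_of_le _ hterm).trans_eq ?_
  rw [← Finset.mul_sum, ← add_pow, hDnorm]
  have h1 : 1 - ‖z‖ ≠ 0 := by linarith
  have h2 : 1 + ‖z‖ ≠ 0 := by positivity
  have h3 := Real.pi_ne_zero
  rw [mul_pow, pow_succ (1 + ‖z‖)]
  field_simp

/-- Two complex numbers can be rotated in opposite directions so as to be aligned. -/
lemma exists_norm_eq_one_and_norm_add_norm_eq (a b : ℂ) :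
    ∃ l : ℂ, ‖l‖ = 1 ∧ ‖a‖ + ‖b‖ = ‖l * a + conj l * b‖ := by
  refine ⟨exp (((b.arg - a.arg) / 2 : ℝ) * I), norm_exp_ofReal_mul_I _, ?_⟩
  have h1 : exp (((b.arg - a.arg) / 2 : ℝ) * I) * a +
      conj (exp (((b.arg - a.arg) / 2 : ℝ) * I)) * b =
      ((‖a‖ + ‖b‖ : ℝ) : ℂ) * exp (((a.arg + b.arg) / 2 : ℝ) * I) := by
    conv_lhs => rw [← norm_mul_exp_arg_mul_I a, ← norm_mul_exp_arg_mul_I b]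
    rw [← exp_conj, mul_left_comm, mul_left_comm _ (‖b‖ : ℂ)]
    simp only [norm_mul_exp_arg_mul_I]
    rw [← exp_add, ← exp_add, map_mul, conj_ofReal, conj_I, ofReal_add, add_mul]
    congr 3 <;> push_cast <;> ring
  rw [h1, norm_mul, norm_exp_ofReal_mul_I, norm_real, mul_one,
    Real.norm_of_nonneg (by positivity)]

/-- **Schwarz–Pick lemma of higher order for harmonic mappings.**
Let `f = h + conj g` be a harmonic mapping of the unit disk into `ℂ` with `|f| ≤ M`.
Then for every `n ≥ 1` and `z` in the disk,
`|h⁽ⁿ⁾(z)| + |g⁽ⁿ⁾(z)| ≤ 4·M·n! / (π·(1-|z|)ⁿ·(1+|z|))`. -/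
theorem schwarz_pick_higher_order_harmonic
    (h g : ℂ → ℂ) (M : ℝ) (hM : 0 < M)
    (hh : DifferentiableOn ℂ h (ball (0 : ℂ) 1))
    (hg : DifferentiableOn ℂ g (ball (0 : ℂ) 1))
    (hg0 : g 0 = 0)
    (hbound : ∀ z ∈ ball (0 : ℂ) 1, ‖h z + conj (g z)‖ ≤ M) :
    ∀ n : ℕ, 1 ≤ n → ∀ z ∈ ball (0 : ℂ) 1,
      ‖iteratedDeriv n h z‖ + ‖iteratedDeriv n g z‖ ≤
        4 * M * n.factorial / (Real.pi * (1 - ‖z‖) ^ n * (1 + ‖z‖)) := by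
  intro n hn z hz
  obtain ⟨l, hl, hsum⟩ := exists_norm_eq_one_and_norm_add_norm_eq
    (iteratedDeriv n h z) (iteratedDeriv n g z)
  have hha : AnalyticAt ℂ h z := hh.analyticAt (isOpen_ball.mem_nhds hz)
  have hga : AnalyticAt ℂ g z := hg.analyticAt (isOpen_ball.mem_nhds hz)
  have hF : iteratedDeriv n ((fun w => l * h w) + fun w => conj l * g w) z =
      l * iteratedDeriv n h z + conj l * iteratedDeriv n g z := by
    rw [iteratedDeriv_add (contDiffAt_const.mul hha.contDiffAt)
      (contDiffAt_const.mul hga.contDiffAt), iteratedDeriv_const_mul_field,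
      iteratedDeriv_const_mul_field]
  rw [hsum, ← hF]
  refine norm_iteratedDeriv_le_of_abs_re_le ((hh.const_mul l).add (hg.const_mul (conj l)))
    (fun w hw => ?_) hn hz
  have hre : (((fun w => l * h w) + fun w => conj l * g w) w).re =
      (l * (h w + conj (g w))).re := by
    simp
    ring
  rw [hre]
  refine (abs_re_le_norm _).trans ?_
  rw [norm_mul, hl, one_mul]
  exact hbound w hw
end

section
/- Let f = h + conj(g) be a sense-preserving harmonic mapping on the unit disk 𝔻 (h, g holomorphic on 𝔻) with M_f = sup_{z∈𝔻} Λ_f(z) < ∞ and m_f = inf_{z∈𝔻} λ_f(z) > 0. Then for every θ ∈ [0, 2π) and every z ∈ 𝔻, (1 − |z|²) · |h''(z) + e^{iθ} g''(z)| / |h'(z) + e^{iθ} g'(z)| ≤ (2/π) · log(M_f/m_f). -/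
open Complex Metric Set

open scoped ComplexConjugate

/-- The disk automorphism carrying `0` to `z` maps the disk to itself. -/
lemma norm_add_div_one_add_conj_mul_lt_one {z w : ℂ} (hz : ‖z‖ < 1) (hw : ‖w‖ < 1) :
    1 + conj z * w ≠ 0 ∧ ‖(w + z) / (1 + conj z * w)‖ < 1 := by
  have hprod : ‖conj z * w‖ < 1 := by
    rw [norm_mul, RCLike.norm_conj]
    nlinarith [norm_nonneg z, norm_nonneg w]
  have hne : 1 + conj z * w ≠ 0 := by
    intro h0
    have hneg : conj z * w = -1 := by linear_combination h0
    rw [hneg] at hprod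
    simp at hprod
  refine ⟨hne, ?_⟩
  rw [norm_div, div_lt_one (norm_pos_iff.2 hne), ← sq_lt_sq₀ (norm_nonneg _) (norm_nonneg _)]
  have hz2 : ‖z‖ ^ 2 < 1 := by nlinarith [norm_nonneg z]
  have hw2 : ‖w‖ ^ 2 < 1 := by nlinarith [norm_nonneg w]
  rw [Complex.sq_norm, normSq_apply] at *
  rw [Complex.sq_norm, normSq_apply] at *
  simp only [add_re, add_im, mul_re, mul_im, conj_re, conj_im, one_re, one_im]
  nlinarith [mul_pos (sub_pos.2 hz2) (sub_pos.2 hw2)]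

/-- The Cayley transform centred at `p` maps the right half-plane to the unit disk. -/
lemma norm_sub_div_add_conj_lt_one {p q : ℂ} (hp : 0 < p.re) (hq : 0 < q.re) :
    q + conj p ≠ 0 ∧ ‖(q - p) / (q + conj p)‖ < 1 := by
  have hne : q + conj p ≠ 0 := by
    intro h0
    have := congrArg re h0
    simp only [add_re, conj_re, zero_re] at this
    linarith
  refine ⟨hne, ?_⟩
  rw [norm_div, div_lt_one (norm_pos_iff.2 hne), ← sq_lt_sq₀ (norm_nonneg _) (norm_nonneg _),
    Complex.sq_norm, Complex.sq_norm, normSq_apply, normSq_apply]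
  simp only [add_re, add_im, sub_re, sub_im, conj_re, conj_im]
  nlinarith [mul_pos hp hq]

/-- **Schwarz–Pick lemma** for maps from the unit disk to the right half-plane. -/
lemma one_sub_sq_mul_norm_deriv_le_of_re_pos {P : ℂ → ℂ}
    (hP : DifferentiableOn ℂ P (ball 0 1)) (hre : ∀ w ∈ ball (0 : ℂ) 1, 0 < (P w).re)
    {z : ℂ} (hz : z ∈ ball (0 : ℂ) 1) :
    (1 - ‖z‖ ^ 2) * ‖deriv P z‖ ≤ 2 * (P z).re := by
  have hz1 : ‖z‖ < 1 := by simpa using hz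
  set ψ : ℂ → ℂ := fun w => (w + z) / (1 + conj z * w) with hψ
  set Q : ℂ → ℂ := fun w => (P w - P z) / (P w + conj (P z)) with hQ
  have hψmaps : MapsTo ψ (ball 0 1) (ball 0 1) := fun w hw => by
    exact mem_ball_zero_iff.2 (norm_add_div_one_add_conj_mul_lt_one hz1 (by simpa using hw)).2
  have hQmaps : MapsTo Q (ball 0 1) (ball 0 1) := fun w hw => by
    exact mem_ball_zero_iff.2 (norm_sub_div_add_conj_lt_one (hre z hz) (hre w hw)).2
  have hψd : DifferentiableOn ℂ ψ (ball 0 1) :=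
    DifferentiableOn.div (by fun_prop) (by fun_prop) fun w hw =>
      (norm_add_div_one_add_conj_mul_lt_one hz1 (by simpa using hw)).1
  have hQd : DifferentiableOn ℂ Q (ball 0 1) :=
    (hP.sub_const _).div (hP.add_const _) fun w hw =>
      (norm_sub_div_add_conj_lt_one (hre z hz) (hre w hw)).1
  have hψ0 : ψ 0 = z := by simp [hψ]
  have hQz : Q z = 0 := by simp [hQ]
  have hcenter : (Q ∘ ψ) 0 = 0 := by simp [hψ0, hQz]
  have hle : ‖deriv (Q ∘ ψ) 0‖ ≤ 1 := by
    refine norm_deriv_le_one_of_mapsTo_ball (R := 1) (hQd.comp hψd hψmaps) ?_ one_pos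
    rw [hcenter]
    exact (hQmaps.comp hψmaps).mono_right ball_subset_closedBall
  have hψ' : HasDerivAt ψ (1 - conj z * z) 0 := by
    refine (((hasDerivAt_id (0 : ℂ)).add_const z).div
      (((hasDerivAt_id (0 : ℂ)).const_mul (conj z)).const_add 1) (by simp)).congr_deriv ?_
    simp [mul_comm]
  have hPz : HasDerivAt P (deriv P z) z :=
    (hP.differentiableAt (isOpen_ball.mem_nhds hz)).hasDerivAt
  have hne : P z + conj (P z) ≠ 0 := (norm_sub_div_add_conj_lt_one (hre z hz) (hre z hz)).1
  have hQ' : HasDerivAt Q (deriv P z / (P z + conj (P z))) (ψ 0) := by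
    rw [hψ0]
    refine ((hPz.sub_const (P z)).div (hPz.add_const (conj (P z))) hne).congr_deriv ?_
    field_simp
    ring
  rw [(hQ'.comp 0 hψ').deriv, norm_mul, norm_div, add_conj, conj_mul'] at hle
  have h1 : ‖(1 : ℂ) - (‖z‖ : ℂ) ^ 2‖ = 1 - ‖z‖ ^ 2 := by
    rw [← ofReal_pow, ← ofReal_one, ← ofReal_sub, norm_real, Real.norm_of_nonneg]
    nlinarith [norm_nonneg z]
  have h2 : ‖((2 * (P z).re : ℝ) : ℂ)‖ = 2 * (P z).re := by
    rw [norm_real, Real.norm_of_nonneg]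
    linarith [hre z hz]
  rw [h1, h2, div_mul_eq_mul_div, div_le_one (by linarith [hre z hz])] at hle
  linarith

/-- **Schwarz–Pick lemma** for maps from the unit disk to a vertical strip. -/
lemma one_sub_sq_mul_norm_deriv_le_of_re_mem_Ioo {F : ℂ → ℂ} {a b : ℝ}
    (hF : DifferentiableOn ℂ F (ball 0 1)) (hre : ∀ w ∈ ball (0 : ℂ) 1, (F w).re ∈ Ioo a b)
    {z : ℂ} (hz : z ∈ ball (0 : ℂ) 1) :
    (1 - ‖z‖ ^ 2) * ‖deriv F z‖ ≤ 2 / Real.pi * (b - a) := by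
  have hab : 0 < b - a := by linarith [(hre z hz).1, (hre z hz).2]
  have hπ := Real.pi_pos
  set t : ℝ := Real.pi / (b - a) with ht
  have htpos : 0 < t := by positivity
  have htab : t * (b - a) = Real.pi := by rw [ht]; field_simp
  set u : ℂ → ℂ := fun w => I * t * (F w - ((a + b) / 2 : ℝ)) with hu
  have hud : DifferentiableOn ℂ u (ball 0 1) := (hF.sub_const _).const_mul _
  have him : ∀ w, (u w).im = t * ((F w).re - (a + b) / 2) := fun w => by
    rw [hu]
    simp only [mul_im, mul_re, I_re, I_im, ofReal_re, ofReal_im, sub_re, sub_im]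
    ring
  have hcos : ∀ w ∈ ball (0 : ℂ) 1, 0 < Real.cos (u w).im := fun w hw => by
    obtain ⟨h1, h2⟩ := hre w hw
    rw [him]
    apply Real.cos_pos_of_mem_Ioo
    constructor <;> nlinarith
  have hexp := one_sub_sq_mul_norm_deriv_le_of_re_pos hud.cexp
    (fun w hw => by rw [exp_re]; exact mul_pos (Real.exp_pos _) (hcos w hw)) hz
  have hFz := (hF.differentiableAt (isOpen_ball.mem_nhds hz)).hasDerivAt
  have hu' : HasDerivAt u (I * t * deriv F z) z := (hFz.sub_const _).const_mul _
  rw [hu'.cexp.deriv, norm_mul, norm_exp, exp_re, norm_mul, norm_mul, norm_I, one_mul, norm_real,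
    Real.norm_of_nonneg htpos.le] at hexp
  have hE := Real.exp_pos (u z).re
  have hscaled : (1 - ‖z‖ ^ 2) * (t * ‖deriv F z‖) ≤ 2 := by
    refine le_of_mul_le_mul_left ?_ hE
    nlinarith [Real.cos_le_one (u z).im]
  rw [div_mul_eq_mul_div, le_div_iff₀ hπ, ← htab]
  nlinarith

/-- A nonvanishing holomorphic function on a disk has a holomorphic logarithm. -/
lemma exists_hasDerivAt_exp_eq_of_ne_zero {k : ℂ → ℂ} {c : ℂ} {r : ℝ}
    (hk : DifferentiableOn ℂ k (ball c r)) (hne : ∀ w ∈ ball c r, k w ≠ 0) :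
    ∃ F : ℂ → ℂ, ∀ w ∈ ball c r, HasDerivAt F (deriv k w / k w) w ∧ exp (F w) = k w := by
  rcases le_or_gt r 0 with hr | hr
  · exact ⟨0, by simp [ball_eq_empty.2 hr]⟩
  obtain ⟨F, hFc, hF⟩ :=
    ((hk.deriv isOpen_ball).div hk hne).isExactOn_ball.with_val_at c (log (k c))
  refine ⟨F, fun w hw => ⟨hF w hw, ?_⟩⟩
  have hderiv : ∀ w ∈ ball c r, HasDerivAt (fun w => k w * exp (-F w)) 0 w := fun w hw => by
    have hkw := (hk.differentiableAt (isOpen_ball.mem_nhds hw)).hasDerivAt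
    refine (hkw.mul (hF w hw).neg.cexp).congr_deriv ?_
    have := hne w hw
    simp only [Pi.div_apply]
    field_simp
    ring
  have hc : c ∈ ball c r := mem_ball_self hr
  have hconst := isOpen_ball.is_const_of_deriv_eq_zero (convex_ball c r).isPreconnected
    (fun w hw => (hderiv w hw).differentiableAt.differentiableWithinAt)
    (fun w hw => (hderiv w hw).deriv) hw hc
  simp only [hFc, exp_neg, exp_log (hne c hc), mul_inv_cancel₀ (hne c hc)] at hconst
  rw [mul_inv_eq_one₀ (exp_ne_zero _)] at hconst
  exact hconst.symm

/-- Bound on the logarithmic derivative of a holomorphic function on the unit disk whose modulus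
lies between two positive constants. -/
lemma one_sub_sq_mul_norm_deriv_div_le_log {k : ℂ → ℂ} {m M : ℝ} (hm : 0 < m)
    (hk : DifferentiableOn ℂ k (ball 0 1))
    (hbound : ∀ w ∈ ball (0 : ℂ) 1, ‖k w‖ ∈ Icc m M) {z : ℂ} (hz : z ∈ ball (0 : ℂ) 1) :
    (1 - ‖z‖ ^ 2) * ‖deriv k z / k z‖ ≤ 2 / Real.pi * Real.log (M / m) := by
  have hpos : ∀ w ∈ ball (0 : ℂ) 1, 0 < ‖k w‖ := fun w hw => hm.trans_le (hbound w hw).1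
  have hM : 0 < M := (hpos z hz).trans_le (hbound z hz).2
  obtain ⟨F, hF⟩ := exists_hasDerivAt_exp_eq_of_ne_zero hk fun w hw => norm_pos_iff.1 (hpos w hw)
  have hFre : ∀ w ∈ ball (0 : ℂ) 1, (F w).re = Real.log ‖k w‖ := fun w hw => by
    rw [← (hF w hw).2, norm_exp, Real.log_exp]
  rw [← (hF z hz).1.deriv, Real.log_div hM.ne' hm.ne']
  have hπ := Real.pi_pos
  refine le_of_forall_pos_le_add fun ε hε => ?_
  set δ : ℝ := ε * Real.pi / 4 with hδ
  have hδpos : 0 < δ := by positivity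
  refine (one_sub_sq_mul_norm_deriv_le_of_re_mem_Ioo (a := Real.log m - δ) (b := Real.log M + δ)
    (fun w hw => (hF w hw).1.differentiableAt.differentiableWithinAt) (fun w hw => ?_) hz).trans_eq
    ?_
  · rw [hFre w hw]
    constructor
    · linarith [Real.log_le_log hm (hbound w hw).1]
    · linarith [Real.log_le_log (hpos w hw) (hbound w hw).2]
  · rw [hδ]
    field_simp
    ring

/-- Let `f = h + conj g` be a sense-preserving harmonic mapping on the unit disk with
`M_f = sup Λ_f < ∞` and `m_f = inf λ_f > 0`. Then for every `θ ∈ [0, 2π)` and `z ∈ 𝔻`,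
`(1-|z|²)·|h''(z) + e^{iθ}g''(z)| / |h'(z) + e^{iθ}g'(z)| ≤ (2/π)·log(M_f/m_f)`. -/
theorem pre_schwarzian_bound_of_sense_preserving
    (h g : ℂ → ℂ) (M m : ℝ)
    (hh : DifferentiableOn ℂ h (ball (0 : ℂ) 1))
    (hg : DifferentiableOn ℂ g (ball (0 : ℂ) 1))
    (hsp : ∀ z ∈ ball (0 : ℂ) 1, ‖deriv g z‖ < ‖deriv h z‖)
    (hM : IsLUB ((fun z => ‖deriv h z‖ + ‖deriv g z‖) '' ball (0 : ℂ) 1) M)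
    (hm : IsGLB ((fun z => |‖deriv h z‖ - ‖deriv g z‖|) '' ball (0 : ℂ) 1) m)
    (hm0 : 0 < m) :
    ∀ θ ∈ Ico (0 : ℝ) (2 * Real.pi), ∀ z ∈ ball (0 : ℂ) 1,
      (1 - ‖z‖ ^ 2) *
          ‖iteratedDeriv 2 h z + Complex.exp (θ * Complex.I) * iteratedDeriv 2 g z‖ /
          ‖deriv h z + Complex.exp (θ * Complex.I) * deriv g z‖ ≤
        (2 / Real.pi) * Real.log (M / m) := by
  intro θ _ z hz
  set e : ℂ := Complex.exp (θ * Complex.I)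
  have hnorm : ‖e‖ = 1 := norm_exp_ofReal_mul_I θ
  have hh' := hh.deriv isOpen_ball
  have hg' := hg.deriv isOpen_ball
  have hbound : ∀ w ∈ ball (0 : ℂ) 1, ‖deriv h w + e * deriv g w‖ ∈ Icc m M := fun w hw => by
    have hlow := hm.1 (mem_image_of_mem _ hw)
    have hup := hM.1 (mem_image_of_mem _ hw)
    simp only [abs_of_pos (sub_pos.2 (hsp w hw))] at hlow hup
    have hmul : ‖e * deriv g w‖ = ‖deriv g w‖ := by rw [norm_mul, hnorm, one_mul]
    constructor
    · linarith [norm_sub_le_norm_add (deriv h w) (e * deriv g w)]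
    · linarith [norm_add_le (deriv h w) (e * deriv g w)]
  have hderiv : deriv (fun w => deriv h w + e * deriv g w) z =
      iteratedDeriv 2 h z + e * iteratedDeriv 2 g z := by
    have hhz := (hh'.differentiableAt (isOpen_ball.mem_nhds hz)).hasDerivAt
    have hgz := (hg'.differentiableAt (isOpen_ball.mem_nhds hz)).hasDerivAt
    simp only [iteratedDeriv_succ, iteratedDeriv_zero]
    exact (hhz.add (hgz.const_mul e)).deriv
  have hmain := one_sub_sq_mul_norm_deriv_div_le_log hm0 (hh'.add (hg'.const_mul e)) hbound hz
  rw [mul_div_assoc, ← norm_div, ← hderiv]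
  exact hmain
end

section
/- Let f = h + conj(g) be a sense-preserving harmonic mapping on the unit disk 𝔻 (h, g holomorphic on 𝔻) with M_f = sup_{z∈𝔻} Λ_f(z) < ∞ and m_f = inf_{z∈𝔻} λ_f(z) > 0. If M_f/m_f ≤ e^{π/2}, then f is univalent (injective) on 𝔻. Equivalently, every non-univalent sense-preserving harmonic mapping f on 𝔻 with m_f > 0 satisfies M_f/m_f > e^{π/2}, so the harmonic John constant is at least e^{π/2}. -/
open Complex Metric Set ComplexConjugate
open Filter Topology Asymptotics

/-- A proper local homeomorphism onto a connected Hausdorff space is injective as soon as one of its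
fibres is a singleton. -/
lemma IsLocalHomeomorph.injective_of_isProperMap {X Y : Type*} [TopologicalSpace X] [T2Space X]
    [TopologicalSpace Y] [T2Space Y] [PreconnectedSpace Y] {F : X → Y} (hF : IsLocalHomeomorph F)
    (hproper : IsProperMap F) {x₀ : X} (hx₀ : ∀ x, F x = F x₀ → x = x₀) :
    Function.Injective F := by
  set E : Set (X × X) := {p | F p.1 = F p.2 ∧ p.1 ≠ p.2}
  have hEclosed : IsClosed E := by
    rw [← isOpen_compl_iff, isOpen_iff_mem_nhds]
    rintro ⟨a, b⟩ hab
    by_cases h : F a = F b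
    · have hab' : a = b := by
        by_contra hne
        exact hab ⟨h, hne⟩
      subst hab'
      obtain ⟨e, hae, rfl⟩ := hF a
      filter_upwards [prod_mem_nhds (e.open_source.mem_nhds hae) (e.open_source.mem_nhds hae)]
        with p hp hpE
      exact hpE.2 (e.injOn hp.1 hp.2 hpE.1)
    · have hopen : IsOpen {p : X × X | F p.1 ≠ F p.2} :=
        isOpen_ne_fun (hF.continuous.comp continuous_fst) (hF.continuous.comp continuous_snd)
      filter_upwards [hopen.mem_nhds h] with p hp hpE
      exact hp hpE.1
  set D : Set Y := {y | ∃ a b, a ≠ b ∧ F a = y ∧ F b = y}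
  have hDclosed : IsClosed D := by
    have h : D = (fun y => (y, y)) ⁻¹' (Prod.map F F '' E) := by
      ext y
      constructor
      · rintro ⟨a, b, hab, ha, hb⟩
        exact ⟨(a, b), ⟨ha.trans hb.symm, hab⟩, Prod.ext ha hb⟩
      · rintro ⟨⟨a, b⟩, ⟨-, hab⟩, h⟩
        exact ⟨a, b, hab, (Prod.ext_iff.1 h).1, (Prod.ext_iff.1 h).2⟩
    rw [h]
    exact ((hproper.prodMap hproper).isClosedMap E hEclosed).preimage (by fun_prop)
  have hDopen : IsOpen D := by
    rw [isOpen_iff_mem_nhds]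
    rintro y ⟨a, b, hab, rfl, hb⟩
    obtain ⟨U, V, hU, hV, haU, hbV, hUV⟩ := t2_separation hab
    have h1 := (hF.isOpenMap U hU).mem_nhds (mem_image_of_mem F haU)
    have h2 := (hF.isOpenMap V hV).mem_nhds (mem_image_of_mem F hbV)
    rw [hb] at h2
    filter_upwards [h1, h2]
    rintro w ⟨p, hp, rfl⟩ ⟨q, hq, hqp⟩
    exact ⟨p, q, hUV.ne_of_mem hp hq, rfl, hqp⟩
  have hx₀D : F x₀ ∉ D := by
    rintro ⟨a, b, hab, ha, hb⟩
    exact hab ((hx₀ a ha).trans (hx₀ b hb).symm)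
  have hDempty : D = ∅ := by
    rcases isClopen_iff.1 ⟨hDclosed, hDopen⟩ with h | h
    · exact h
    · exact absurd (h ▸ mem_univ (F x₀)) hx₀D
  intro a b hab
  by_contra hne
  exact (hDempty ▸ (⟨a, b, hne, hab, rfl⟩ : F b ∈ D) : F b ∈ (∅ : Set Y))

/-- A self-map of the plane with injective strict real derivative everywhere is a local
homeomorphism. -/
lemma isLocalHomeomorph_of_hasStrictFDerivAt_injective {F : ℂ → ℂ}
    (hF : ∀ z, ∃ D : ℂ →L[ℝ] ℂ, HasStrictFDerivAt F D z ∧ Function.Injective D) :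
    IsLocalHomeomorph F := by
  refine IsLocalHomeomorph.mk F fun z => ?_
  obtain ⟨D, hD, hinj⟩ := hF z
  set e : ℂ ≃L[ℝ] ℂ :=
    (LinearEquiv.ofInjectiveEndo (D : ℂ →ₗ[ℝ] ℂ) hinj).toContinuousLinearEquiv
  have heD : (e : ℂ →L[ℝ] ℂ) = D := by
    rfl
  have hD' : HasStrictFDerivAt F (e : ℂ →L[ℝ] ℂ) z := heD ▸ hD
  exact ⟨hD'.toOpenPartialHomeomorph F, hD'.mem_toOpenPartialHomeomorph_source, fun _ _ => rfl⟩

/-- The retraction of the plane onto the closed unit disk by reflection in the unit circle. -/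
noncomputable def diskReflection (z : ℂ) : ℂ := if ‖z‖ ≤ 1 then z else (conj z)⁻¹

lemma diskReflection_of_norm_le_one {z : ℂ} (hz : ‖z‖ ≤ 1) : diskReflection z = z := if_pos hz

lemma diskReflection_of_one_lt_norm {z : ℂ} (hz : 1 < ‖z‖) :
    diskReflection z = (conj z)⁻¹ := if_neg hz.not_ge

lemma diskReflection_mem_closedBall (z : ℂ) : diskReflection z ∈ closedBall (0 : ℂ) 1 := by
  rw [mem_closedBall_zero_iff]
  rcases le_or_gt ‖z‖ 1 with h | h
  · rwa [diskReflection_of_norm_le_one h]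
  · rw [diskReflection_of_one_lt_norm h, norm_inv, norm_conj]
    exact inv_le_one_of_one_le₀ h.le

lemma norm_diskReflection_sub_of_one_lt {z w : ℂ} (hz : 1 < ‖z‖) (hw : 1 < ‖w‖) :
    ‖diskReflection z - diskReflection w‖ = ‖z - w‖ / (‖z‖ * ‖w‖) := by
  have hz0 : conj z ≠ 0 := (map_ne_zero _).2 (norm_pos_iff.1 (by linarith))
  have hw0 : conj w ≠ 0 := (map_ne_zero _).2 (norm_pos_iff.1 (by linarith))
  rw [diskReflection_of_one_lt_norm hz, diskReflection_of_one_lt_norm hw, inv_sub_inv hz0 hw0,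
    norm_div, norm_mul, norm_conj, norm_conj, ← map_sub, norm_conj, norm_sub_rev]

lemma norm_diskReflection_sub_le (z w : ℂ) :
    ‖diskReflection z - diskReflection w‖ ≤ ‖z - w‖ := by
  have mixed : ∀ {z w : ℂ}, ‖z‖ ≤ 1 → 1 < ‖w‖ →
      ‖diskReflection z - diskReflection w‖ ≤ ‖z - w‖ := by
    intro z w hz hw
    have hw0 : conj w ≠ 0 := (map_ne_zero _).2 (norm_pos_iff.1 (by linarith))
    rw [diskReflection_of_norm_le_one hz, diskReflection_of_one_lt_norm hw,
      show z - (conj w)⁻¹ = (z * conj w - 1) / conj w by field_simp, norm_div, norm_conj]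
    have key : ‖z - w‖ ^ 2 - ‖z * conj w - 1‖ ^ 2 = (1 - ‖z‖ ^ 2) * (‖w‖ ^ 2 - 1) := by
      simp only [← normSq_eq_norm_sq, normSq_apply, sub_re, sub_im, mul_re, mul_im, conj_re,
        conj_im, one_re, one_im]
      ring
    have hle : ‖z * conj w - 1‖ ≤ ‖z - w‖ := by
      refine le_of_sq_le_sq ?_ (norm_nonneg _)
      have : 0 ≤ (1 - ‖z‖ ^ 2) * (‖w‖ ^ 2 - 1) :=
        mul_nonneg (by nlinarith [norm_nonneg z]) (by nlinarith)
      linarith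
    exact (div_le_self (norm_nonneg _) hw.le).trans hle
  rcases le_or_gt ‖z‖ 1 with hz | hz <;> rcases le_or_gt ‖w‖ 1 with hw | hw
  · rw [diskReflection_of_norm_le_one hz, diskReflection_of_norm_le_one hw]
  · exact mixed hz hw
  · rw [norm_sub_rev, norm_sub_rev z]
    exact mixed hw hz
  · rw [norm_diskReflection_sub_of_one_lt hz hw]
    exact div_le_self (norm_nonneg _) (by nlinarith)

lemma continuous_diskReflection : Continuous diskReflection :=
  (LipschitzWith.of_dist_le_mul (K := 1) fun z w => by
    simpa [dist_eq_norm] using norm_diskReflection_sub_le z w).continuous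

/-- The Ahlfors–Becker extension to the plane of a function on the closed unit disk, in terms
of the function and its derivative. -/
noncomputable def beckerExtension (f f' : ℂ → ℂ) (z : ℂ) : ℂ :=
  f (diskReflection z) + (z - diskReflection z) * f' (diskReflection z)

lemma hasStrictFDerivAt_beckerExtension_of_norm_lt_one {f f' : ℂ → ℂ} {z : ℂ} (hz : ‖z‖ < 1)
    (hf : HasStrictDerivAt f (f' z) z) :
    HasStrictFDerivAt (beckerExtension f f')
      ((ContinuousLinearMap.toSpanSingleton ℂ (f' z)).restrictScalars ℝ) z := by
  refine (hf.hasStrictFDerivAt.restrictScalars ℝ).congr_of_eventuallyEq ?_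
  filter_upwards [isOpen_ball.mem_nhds (mem_ball_zero_iff.2 hz)] with w hw
  simp [beckerExtension, diskReflection_of_norm_le_one (mem_ball_zero_iff.1 hw).le]

lemma hasStrictFDerivAt_beckerExtension_of_norm_eq_one {f f' : ℂ → ℂ} {f'' z : ℂ} (hz : ‖z‖ = 1)
    (hf : HasStrictDerivAt f (f' z) z) (hf' : HasStrictDerivAt f' f'' z) :
    HasStrictFDerivAt (beckerExtension f f')
      ((ContinuousLinearMap.toSpanSingleton ℂ (f' z)).restrictScalars ℝ) z := by
  have hπz : diskReflection z = z := diskReflection_of_norm_le_one hz.le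
  have hπ : Tendsto (fun p : ℂ × ℂ => (diskReflection p.1, diskReflection p.2)) (𝓝 (z, z))
      (𝓝 (z, z)) := by
    have : Continuous fun p : ℂ × ℂ => (diskReflection p.1, diskReflection p.2) :=
      (continuous_diskReflection.comp continuous_fst).prodMk
        (continuous_diskReflection.comp continuous_snd)
    simpa [hπz] using this.tendsto (z, z)
  have hfst : Tendsto (fun p : ℂ × ℂ => diskReflection p.1) (𝓝 (z, z)) (𝓝 z) :=
    (continuous_fst.tendsto (z, z)).comp hπ
  have hsnd : Tendsto (fun p : ℂ × ℂ => diskReflection p.2) (𝓝 (z, z)) (𝓝 z) :=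
    (continuous_snd.tendsto (z, z)).comp hπ
  have hO : (fun p : ℂ × ℂ => diskReflection p.1 - diskReflection p.2) =O[𝓝 (z, z)]
      fun p => p.1 - p.2 :=
    IsBigO.of_bound 1 (Eventually.of_forall fun p => by
      simpa using norm_diskReflection_sub_le p.1 p.2)
  refine .of_isLittleO ?_
  have h1 := (hf.hasStrictFDerivAt.isLittleO.comp_tendsto hπ).trans_isBigO hO
  have h2 := ((isBigO_refl (fun p : ℂ × ℂ => p.1 - p.2) (𝓝 (z, z))).sub hO).mul_isLittleO
    ((isLittleO_one_iff ℂ).2 ((hf'.hasDerivAt.continuousAt.tendsto.comp hfst).sub_const (f' z)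
      |>.trans (by simp)))
  have h3 := ((isLittleO_one_iff ℂ).2 (((continuous_snd.tendsto (z, z)).sub hsnd).trans
      (by simp))).mul_isBigO ((hf'.hasStrictFDerivAt.isBigO_sub.comp_tendsto hπ).trans hO)
  refine (((h1.add (by simpa using h2)).add (by simpa using h3)).congr_left fun p => ?_)
  simp [beckerExtension]
  ring

lemma hasStrictFDerivAt_beckerExtension_of_one_lt_norm {f f' : ℂ → ℂ} {f'' z : ℂ} (hz : 1 < ‖z‖)
    (hf : HasStrictDerivAt f (f' (conj z)⁻¹) (conj z)⁻¹)
    (hf' : HasStrictDerivAt f' f'' (conj z)⁻¹) :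
    ∃ D : ℂ →L[ℝ] ℂ, HasStrictFDerivAt (beckerExtension f f') D z ∧
      ∀ v, D v = f' (conj z)⁻¹ * v -
        (z - (conj z)⁻¹) * f'' * ((conj z)⁻¹) ^ 2 * conj v := by
  have hz0 : conj z ≠ 0 := (map_ne_zero _).2 (norm_pos_iff.1 (by linarith))
  have hP := ((hasStrictDerivAt_inv hz0).hasStrictFDerivAt.restrictScalars ℝ).comp z
    conjCLE.hasStrictFDerivAt
  have hfP := (hf.hasStrictFDerivAt.restrictScalars ℝ).comp z hP
  have hf'P := (hf'.hasStrictFDerivAt.restrictScalars ℝ).comp z hP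
  have hF := hfP.add (((hasStrictFDerivAt_id z).sub hP).mul hf'P)
  refine ⟨_, hF.congr_of_eventuallyEq ?_, fun v => ?_⟩
  · filter_upwards [(isOpen_lt continuous_const continuous_norm).mem_nhds hz] with w hw
    simp [beckerExtension, diskReflection_of_one_lt_norm hw]
  · simp
    field_simp
    ring

/-- The tangent maps the strip `|re z| ≤ π / 4` into the closed unit disk. -/
lemma norm_tan_le_one_of_abs_re_le {z : ℂ} (hz : |z.re| ≤ Real.pi / 4) :
    cos z ≠ 0 ∧ ‖tan z‖ ≤ 1 := by
  have hpi := Real.pi_pos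
  have hc : 0 < Real.cos z.re :=
    Real.cos_pos_of_mem_Ioo ⟨by linarith [(abs_le.1 hz).1], by linarith [(abs_le.1 hz).2]⟩
  have hc2 : 0 ≤ Real.cos (2 * z.re) :=
    Real.cos_nonneg_of_mem_Icc ⟨by linarith [(abs_le.1 hz).1], by linarith [(abs_le.1 hz).2]⟩
  have hns : normSq (sin z) = Real.sin z.re ^ 2 + Real.sinh z.im ^ 2 := by
    rw [sin_eq z]
    simp only [← ofReal_sin, ← ofReal_cos, ← ofReal_sinh, ← ofReal_cosh, ← ofReal_mul,
      normSq_add_mul_I]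
    nlinarith [Real.sin_sq_add_cos_sq z.re, Real.cosh_sq z.im]
  have hnc : normSq (cos z) = Real.cos z.re ^ 2 + Real.sinh z.im ^ 2 := by
    rw [cos_eq z, sub_eq_add_neg, ← neg_mul]
    simp only [← ofReal_sin, ← ofReal_cos, ← ofReal_sinh, ← ofReal_cosh, ← ofReal_mul,
      ← ofReal_neg, normSq_add_mul_I]
    nlinarith [Real.sin_sq_add_cos_sq z.re, Real.cosh_sq z.im]
  have hcz : cos z ≠ 0 := by
    rw [← normSq_pos, hnc]
    positivity
  refine ⟨hcz, ?_⟩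
  rw [tan_eq_sin_div_cos, norm_div, div_le_one (norm_pos_iff.2 hcz)]
  refine le_of_sq_le_sq ?_ (norm_nonneg _)
  rw [← normSq_eq_norm_sq, ← normSq_eq_norm_sq, hns, hnc]
  nlinarith [Real.sin_sq_add_cos_sq z.re, Real.cos_two_mul z.re]

/-- A holomorphic function on the unit disk whose modulus stays in `[m, e^{π/2} m]` has logarithmic
derivative at most one at the origin. -/
lemma norm_deriv_zero_le_of_norm_mem_Icc {ψ : ℂ → ℂ} {m : ℝ} (hm : 0 < m)
    (hψ : DifferentiableOn ℂ ψ (ball 0 1))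
    (hb : ∀ z ∈ ball (0 : ℂ) 1, ‖ψ z‖ ∈ Icc m (m * Real.exp (Real.pi / 2))) :
    ‖deriv ψ 0‖ ≤ ‖ψ 0‖ := by
  have h0 : (0 : ℂ) ∈ ball (0 : ℂ) 1 := mem_ball_self one_pos
  have hne : ∀ z ∈ ball (0 : ℂ) 1, ψ z ≠ 0 := fun z hz =>
    norm_pos_iff.1 (hm.trans_le (hb z hz).1)
  set c : ℝ := Real.log m + Real.pi / 4 with hc
  obtain ⟨L, hL0, hL⟩ := ((hψ.deriv isOpen_ball).div hψ hne).isExactOn_ball.with_val_at 0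
    ((Real.log ‖ψ 0‖ - c : ℝ) : ℂ)
  have hψd : ∀ z ∈ ball (0 : ℂ) 1, HasDerivAt ψ (deriv ψ z) z := fun z hz =>
    (hψ.differentiableAt (isOpen_ball.mem_nhds hz)).hasDerivAt
  have hconst : ∀ z ∈ ball (0 : ℂ) 1, ψ z * exp (-L z) = ψ 0 * exp (-L 0) := by
    intro z hz
    have key := Convex.norm_image_sub_le_of_norm_hasDerivWithin_le (C := 0)
      (f := fun z => ψ z * exp (-L z)) (f' := fun _ => 0) (s := ball (0 : ℂ) 1)
      (fun x hx => by
        refine (((hψd x hx).mul (hL x hx).neg.cexp).congr_deriv ?_).hasDerivWithinAt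
        have := hne x hx
        simp only [Pi.div_apply]
        field_simp
        ring) (by simp) (convex_ball _ _) h0 hz
    simpa [sub_eq_zero] using key
  have hre : ∀ z ∈ ball (0 : ℂ) 1, (L z).re = Real.log ‖ψ z‖ - c := by
    intro z hz
    have h := congrArg (fun w => Real.log ‖w‖) (hconst z hz)
    simp only [norm_mul, norm_exp] at h
    rw [Real.log_mul (norm_ne_zero_iff.2 (hne z hz)) (Real.exp_ne_zero _),
      Real.log_mul (norm_ne_zero_iff.2 (hne 0 h0)) (Real.exp_ne_zero _), Real.log_exp,
      Real.log_exp, hL0, neg_re, neg_re, ofReal_re] at h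
    linarith
  have hstrip : ∀ z ∈ ball (0 : ℂ) 1, |(L z).re| ≤ Real.pi / 4 := by
    intro z hz
    have h1 := Real.log_le_log hm (hb z hz).1
    have h2 := Real.log_le_log (hm.trans_le (hb z hz).1) (hb z hz).2
    rw [Real.log_mul hm.ne' (Real.exp_ne_zero _), Real.log_exp] at h2
    rw [hre z hz, abs_le]
    constructor <;> linarith
  have hT : ∀ z ∈ ball (0 : ℂ) 1, HasDerivAt (fun z => tan (L z))
      (1 / cos (L z) ^ 2 * (deriv ψ z / ψ z)) z := fun z hz =>
    (hasDerivAt_tan (norm_tan_le_one_of_abs_re_le (hstrip z hz)).1).comp z (hL z hz)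
  have hcos : ‖cos (L 0)‖ ≤ 1 := by
    rw [hL0, ← ofReal_cos, norm_real]
    exact Real.abs_cos_le_one _
  have hcos0 := (norm_tan_le_one_of_abs_re_le (hstrip 0 h0)).1
  have hle : ‖deriv ψ 0 / ψ 0‖ ≤ ‖deriv (fun z => tan (L z)) 0‖ := by
    rw [(hT 0 h0).deriv, norm_mul, norm_div 1, norm_one, norm_pow]
    refine le_mul_of_one_le_left (norm_nonneg _) ?_
    rw [one_le_div (by positivity)]
    exact pow_le_one₀ (norm_nonneg _) hcos
  have hcauchy : ‖deriv (fun z => tan (L z)) 0‖ ≤ 1 := by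
    by_contra! ha
    set a := ‖deriv (fun z => tan (L z)) 0‖
    have hR1 : (1 + 1 / a) / 2 < 1 := by
      have : 1 / a < 1 := (div_lt_one (by linarith)).2 ha
      linarith
    have hR0 : 0 < (1 + 1 / a) / 2 := by positivity
    have hsub : closedBall (0 : ℂ) ((1 + 1 / a) / 2) ⊆ ball 0 1 := closedBall_subset_ball hR1
    have hd : DiffContOnCl ℂ (fun z => tan (L z)) (ball 0 ((1 + 1 / a) / 2)) :=
      DifferentiableOn.diffContOnCl fun z hz =>
        (hT z (hsub (closure_ball_subset_closedBall hz))).differentiableAt.differentiableWithinAt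
    have h := norm_deriv_le_of_forall_mem_sphere_norm_le hR0 hd (C := 1) fun z hz =>
      (norm_tan_le_one_of_abs_re_le (hstrip z (hsub (sphere_subset_closedBall hz)))).2
    rw [le_div_iff₀ hR0] at h
    have : a * ((1 + 1 / a) / 2) = (a + 1) / 2 := by field_simp
    linarith
  have := hle.trans hcauchy
  rwa [norm_div, div_le_one (norm_pos_iff.2 (hne 0 h0))] at this

/-- A holomorphic function on the unit disk whose modulus stays in `[m, e^{π/2} m]` has hyperbolic
logarithmic derivative at most one. -/
lemma one_sub_sq_mul_norm_deriv_le_of_norm_mem_Icc {ψ : ℂ → ℂ} {m : ℝ} (hm : 0 < m)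
    (hψ : DifferentiableOn ℂ ψ (ball 0 1))
    (hb : ∀ z ∈ ball (0 : ℂ) 1, ‖ψ z‖ ∈ Icc m (m * Real.exp (Real.pi / 2)))
    {a : ℂ} (ha : a ∈ ball (0 : ℂ) 1) :
    (1 - ‖a‖ ^ 2) * ‖deriv ψ a‖ ≤ ‖ψ a‖ := by
  have ha1 : ‖a‖ < 1 := mem_ball_zero_iff.1 ha
  have hden : ∀ z ∈ ball (0 : ℂ) 1, 1 + conj a * z ≠ 0 := by
    intro z hz h
    have hz1 : ‖z‖ < 1 := mem_ball_zero_iff.1 hz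
    have h1 : ‖conj a * z‖ = 1 := by
      rw [← neg_eq_of_add_eq_zero_right h, norm_neg, norm_one]
    rw [norm_mul, norm_conj] at h1
    nlinarith [norm_nonneg a, norm_nonneg z]
  have hμd : ∀ z ∈ ball (0 : ℂ) 1, HasDerivAt (fun z => (z + a) / (1 + conj a * z))
      ((1 * (1 + conj a * z) - (z + a) * (conj a * 1)) / (1 + conj a * z) ^ 2) z := fun z hz =>
    ((hasDerivAt_id z).add_const a).div (((hasDerivAt_id z).const_mul (conj a)).const_add 1)
      (hden z hz)
  have hmaps : MapsTo (fun z => (z + a) / (1 + conj a * z)) (ball (0 : ℂ) 1) (ball 0 1) := by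
    intro z hz
    have hz1 : ‖z‖ < 1 := mem_ball_zero_iff.1 hz
    rw [mem_ball_zero_iff, norm_div, div_lt_one (norm_pos_iff.2 (hden z hz))]
    refine lt_of_pow_lt_pow_left₀ 2 (norm_nonneg _) ?_
    have key : ‖1 + conj a * z‖ ^ 2 - ‖z + a‖ ^ 2 = (1 - ‖a‖ ^ 2) * (1 - ‖z‖ ^ 2) := by
      simp only [← normSq_eq_norm_sq, normSq_apply, add_re, add_im, mul_re, mul_im, conj_re,
        conj_im, one_re, one_im]
      ring
    have : 0 < (1 - ‖a‖ ^ 2) * (1 - ‖z‖ ^ 2) :=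
      mul_pos (by nlinarith [norm_nonneg a]) (by nlinarith [norm_nonneg z])
    linarith
  have h := norm_deriv_zero_le_of_norm_mem_Icc hm
    (hψ.comp (fun z hz => (hμd z hz).differentiableAt.differentiableWithinAt) hmaps)
    (fun z hz => hb _ (hmaps hz))
  have hd : HasDerivAt (ψ ∘ fun z => (z + a) / (1 + conj a * z))
      (deriv ψ a * (1 - a * conj a)) 0 := by
    have h1 := hμd 0 (mem_ball_self one_pos)
    have h2 := (hψ.differentiableAt (isOpen_ball.mem_nhds ha)).hasDerivAt
    have h3 : (0 + a) / (1 + conj a * 0) = a := by simp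
    have h4 := HasDerivAt.comp (0 : ℂ) (h₂ := ψ) (by rw [h3]; exact h2) h1
    exact h4.congr_deriv (by simp)
  have hnorm : ‖(1 : ℂ) - a * conj a‖ = 1 - ‖a‖ ^ 2 := by
    rw [mul_conj, normSq_eq_norm_sq, ← ofReal_one, ← ofReal_sub, norm_real,
      Real.norm_of_nonneg (by nlinarith [norm_nonneg a])]
  rw [hd.deriv, norm_mul, hnorm] at h
  simpa [mul_comm] using h

/-- **Becker's univalence criterion**, for functions holomorphic beyond the closed unit disk. -/
lemma injOn_closedBall_of_one_sub_sq_mul_norm_le {f f' f'' : ℂ → ℂ} {ρ : ℝ} (hρ : 1 < ρ)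
    (hf : ∀ z ∈ ball (0 : ℂ) ρ, HasDerivAt f (f' z) z)
    (hf' : ∀ z ∈ ball (0 : ℂ) ρ, HasDerivAt f' (f'' z) z)
    (hne : ∀ z ∈ closedBall (0 : ℂ) 1, f' z ≠ 0)
    (hB : ∀ z ∈ ball (0 : ℂ) 1, (1 - ‖z‖ ^ 2) * ‖f'' z‖ ≤ ‖f' z‖) :
    InjOn f (closedBall 0 1) := by
  have hsub : closedBall (0 : ℂ) 1 ⊆ ball 0 ρ := closedBall_subset_ball hρ
  have strict : ∀ {g g' : ℂ → ℂ}, (∀ z ∈ ball (0 : ℂ) ρ, HasDerivAt g (g' z) z) →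
      ∀ z ∈ closedBall (0 : ℂ) 1, HasStrictDerivAt g (g' z) z := by
    intro g g' hg z hz
    have h : DifferentiableOn ℂ g (ball 0 ρ) := fun w hw =>
      (hg w hw).differentiableAt.differentiableWithinAt
    have := (h.analyticAt (isOpen_ball.mem_nhds (hsub hz))).hasStrictDerivAt
    rwa [(hg z (hsub hz)).deriv] at this
  have hfs := strict hf
  have hfs' := strict hf'
  set F := beckerExtension f f' with hF
  have hFf : ∀ z ∈ closedBall (0 : ℂ) 1, F z = f z := fun z hz => by
    simp [hF, beckerExtension, diskReflection_of_norm_le_one (mem_closedBall_zero_iff.1 hz)]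
  have hderiv : ∀ z, ∃ D : ℂ →L[ℝ] ℂ, HasStrictFDerivAt F D z ∧ Function.Injective D := by
    intro z
    have inj : z ∈ closedBall (0 : ℂ) 1 → Function.Injective
        ((ContinuousLinearMap.toSpanSingleton ℂ (f' z)).restrictScalars ℝ) := by
      intro hz v w hvw
      simpa [hne z hz] using hvw
    rcases lt_trichotomy ‖z‖ 1 with hz | hz | hz
    · have hz' : z ∈ closedBall (0 : ℂ) 1 := mem_closedBall_zero_iff.2 hz.le
      exact ⟨_, hasStrictFDerivAt_beckerExtension_of_norm_lt_one hz (hfs z hz'), inj hz'⟩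
    · have hz' : z ∈ closedBall (0 : ℂ) 1 := mem_closedBall_zero_iff.2 hz.le
      exact ⟨_, hasStrictFDerivAt_beckerExtension_of_norm_eq_one hz (hfs z hz') (hfs' z hz'),
        inj hz'⟩
    · have hζ : (conj z)⁻¹ ∈ ball (0 : ℂ) 1 := by
        rw [mem_ball_zero_iff, norm_inv, norm_conj]
        exact inv_lt_one_of_one_lt₀ hz
      obtain ⟨D, hD, hDv⟩ := hasStrictFDerivAt_beckerExtension_of_one_lt_norm hz
        (hfs _ (ball_subset_closedBall hζ)) (hfs' _ (ball_subset_closedBall hζ))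
      refine ⟨D, hD, (injective_iff_map_eq_zero D).2 fun v hv => ?_⟩
      by_contra hv0
      have hz0 : z ≠ 0 := norm_pos_iff.1 (by linarith)
      have hz0' : conj z ≠ 0 := (map_ne_zero _).2 hz0
      have hnorm : ‖(z - (conj z)⁻¹) * ((conj z)⁻¹) ^ 2‖ =
          (1 - ‖(conj z)⁻¹‖ ^ 2) * ‖(conj z)⁻¹‖ := by
        have h1 : z - (conj z)⁻¹ = ((‖z‖ ^ 2 - 1 : ℝ) : ℂ) * (conj z)⁻¹ := by
          rw [← normSq_eq_norm_sq, ofReal_sub, ← mul_conj, ofReal_one]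
          field_simp
        rw [h1, norm_mul, norm_mul, norm_real, norm_pow, norm_inv, norm_conj,
          Real.norm_of_nonneg (by nlinarith)]
        field_simp
      rw [hDv, sub_eq_zero] at hv
      have hv' := congrArg norm hv
      rw [mul_right_comm (z - _), norm_mul, norm_mul, norm_mul, hnorm, norm_conj] at hv'
      have hvpos := norm_pos_iff.2 hv0
      have h2 := hB _ hζ
      have h3 := norm_pos_iff.2 (hne _ (ball_subset_closedBall hζ))
      have h4 := mem_ball_zero_iff.1 hζ
      have h5 := mul_right_cancel₀ hvpos.ne' hv'
      nlinarith [norm_nonneg (conj z)⁻¹]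
  have hlocal := isLocalHomeomorph_of_hasStrictFDerivAt_injective hderiv
  have hcpt := isCompact_closedBall (0 : ℂ) 1
  have hcont : ContinuousOn f (closedBall 0 1) := fun z hz =>
    (hfs z hz).hasDerivAt.continuousAt.continuousWithinAt
  have hcont' : ContinuousOn f' (closedBall 0 1) := fun z hz =>
    (hfs' z hz).hasDerivAt.continuousAt.continuousWithinAt
  have hcont'' : ContinuousOn f'' (closedBall 0 1) := by
    have h : DifferentiableOn ℂ f' (ball 0 ρ) := fun w hw =>
      (hf' w hw).differentiableAt.differentiableWithinAt
    exact ((h.deriv isOpen_ball).continuousOn.congr fun z hz => (hf' z hz).deriv.symm).mono hsub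
  obtain ⟨c, hc, hcle⟩ : ∃ c > 0, ∀ z ∈ closedBall (0 : ℂ) 1, c ≤ ‖f' z‖ := by
    obtain ⟨z, hz, hmin⟩ := hcpt.exists_isMinOn ⟨0, mem_closedBall_self zero_le_one⟩ hcont'.norm
    exact ⟨‖f' z‖, norm_pos_iff.2 (hne z hz), fun w hw => hmin hw⟩
  obtain ⟨C, hC⟩ := hcpt.exists_bound_of_continuousOn
    (hcont.sub (continuousOn_id.mul hcont'))
  obtain ⟨L, hL⟩ := hcpt.exists_bound_of_continuousOn hcont''
  have hL0 : 0 ≤ L := (norm_nonneg _).trans (hL 0 (mem_closedBall_self zero_le_one))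
  have hFz : ∀ z, F z = z * f' (diskReflection z) +
      (f (diskReflection z) - diskReflection z * f' (diskReflection z)) := fun z => by
    rw [hF, beckerExtension]
    ring
  have hgrowth : Tendsto (fun z => ‖F z‖) (cocompact ℂ) atTop := by
    refine tendsto_atTop_mono (f := fun z => c * ‖z‖ + -C) (fun z => ?_)
      (tendsto_atTop_add_const_right _ _ (tendsto_norm_cocompact_atTop.const_mul_atTop hc))
    have h1 := hC _ (diskReflection_mem_closedBall z)
    have h2 := hcle _ (diskReflection_mem_closedBall z)
    have h3 := norm_sub_le_norm_add (z * f' (diskReflection z))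
      (f (diskReflection z) - diskReflection z * f' (diskReflection z))
    rw [← hFz, norm_mul] at h3
    simp only [Pi.sub_apply, Pi.mul_apply, id] at h1
    nlinarith [norm_nonneg z]
  have hproper : IsProperMap F := isProperMap_iff_tendsto_cocompact.2
    ⟨hlocal.continuous, by
      rw [← cobounded_eq_cocompact (α := ℂ)] at hgrowth ⊢
      exact tendsto_norm_atTop_iff_cobounded.1 hgrowth⟩
  have hlip' : ∀ z ∈ closedBall (0 : ℂ) 1, ∀ w ∈ closedBall (0 : ℂ) 1,
      ‖f' z - f' w‖ ≤ L * ‖z - w‖ := fun z hz w hw =>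
    (convex_closedBall (0 : ℂ) 1).norm_image_sub_le_of_norm_hasDerivWithin_le
      (fun x hx => (hfs' x hx).hasDerivAt.hasDerivWithinAt) hL hw hz
  have hlip : ∀ z ∈ closedBall (0 : ℂ) 1, ∀ w ∈ closedBall (0 : ℂ) 1,
      ‖(f z - z * f' z) - (f w - w * f' w)‖ ≤ L * ‖z - w‖ := fun z hz w hw =>
    Convex.norm_image_sub_le_of_norm_hasDerivWithin_le (f := fun z => f z - z * f' z)
      (f' := fun z => -(z * f'' z))
      (fun x hx => (((hfs x hx).hasDerivAt.sub ((hasDerivAt_id x).mul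
        (hfs' x hx).hasDerivAt)).congr_deriv (by simp)).hasDerivWithinAt)
      (fun x hx => by
        rw [norm_neg, norm_mul]
        have h1 := hL x hx
        have h2 := mem_closedBall_zero_iff.1 hx
        nlinarith [norm_nonneg (f'' x), norm_nonneg x]) (convex_closedBall (0 : ℂ) 1) hw hz
  set R := 2 * L / c + 1 with hR
  have hR1 : 1 ≤ R := by
    have : 0 ≤ 2 * L / c := by positivity
    linarith
  have hfar : ∀ p q, R < ‖p‖ → R < ‖q‖ → F p = F q → p = q := by
    intro p q hp hq hpq
    have hp1 := hR1.trans_lt hp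
    have hq1 := hR1.trans_lt hq
    set ζ := diskReflection p with hζ
    set η := diskReflection q with hη
    have hζm : ζ ∈ closedBall (0 : ℂ) 1 := diskReflection_mem_closedBall p
    have hηm : η ∈ closedBall (0 : ℂ) 1 := diskReflection_mem_closedBall q
    have heq : (p - q) * f' ζ =
        -(((f ζ - ζ * f' ζ) - (f η - η * f' η)) + q * (f' ζ - f' η)) := by
      rw [hFz, hFz] at hpq
      linear_combination hpq
    have hdist : ‖p‖ * ‖q‖ * ‖ζ - η‖ = ‖p - q‖ := by
      rw [hζ, hη, norm_diskReflection_sub_of_one_lt hp1 hq1]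
      field_simp
    have hle : ‖p - q‖ * c ≤ L * ‖ζ - η‖ + ‖q‖ * (L * ‖ζ - η‖) := by
      calc ‖p - q‖ * c ≤ ‖p - q‖ * ‖f' ζ‖ := by gcongr; exact hcle ζ hζm
        _ = ‖((f ζ - ζ * f' ζ) - (f η - η * f' η)) + q * (f' ζ - f' η)‖ := by
          rw [← norm_mul, heq, norm_neg]
        _ ≤ _ := by
          refine (norm_add_le _ _).trans ?_
          rw [norm_mul]
          gcongr
          · exact hlip ζ hζm η hηm
          · exact hlip' ζ hζm η hηm
    have hle2 : ‖p - q‖ * c ≤ 2 * L * (‖q‖ * ‖ζ - η‖) := by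
      have : L * ‖ζ - η‖ ≤ ‖q‖ * (L * ‖ζ - η‖) :=
        le_mul_of_one_le_left (by positivity) hq1.le
      linarith
    have hcp : 2 * L < c * ‖p‖ := by
      have h1 : c * R = 2 * L + c := by
        rw [hR]
        field_simp
      nlinarith
    have hzero : ‖q‖ * ‖ζ - η‖ = 0 := by
      by_contra h0
      have hpos : 0 < ‖q‖ * ‖ζ - η‖ := lt_of_le_of_ne (by positivity) (Ne.symm h0)
      have := mul_lt_mul_of_pos_right hcp hpos
      rw [← hdist] at hle2
      nlinarith
    rw [← sub_eq_zero, ← norm_eq_zero, ← hdist, mul_assoc, hzero, mul_zero]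
  obtain ⟨K, hK⟩ := (isCompact_closedBall (0 : ℂ) R).exists_bound_of_continuousOn
    hlocal.continuous.continuousOn
  obtain ⟨x₀, hx₀⟩ := (hgrowth.eventually_gt_atTop K).exists
  have hlarge : ∀ x, F x = F x₀ → R < ‖x‖ := by
    intro x hx
    by_contra! h
    have := hK x (mem_closedBall_zero_iff.2 h)
    rw [hx] at this
    linarith
  have hinj := hlocal.injective_of_isProperMap hproper (x₀ := x₀) fun x hx =>
    hfar x x₀ (hlarge x hx) (hlarge x₀ rfl) hx
  intro z hz w hw hzw
  exact hinj (by rw [hFf z hz, hFf w hw, hzw])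

/-- **John's univalence criterion**: a holomorphic function on the unit disk whose derivative has
modulus in `[m, e^{π/2} m]` for some `m > 0` is injective. -/
lemma injOn_ball_of_norm_deriv_mem_Icc {f : ℂ → ℂ} {m : ℝ} (hm : 0 < m)
    (hf : DifferentiableOn ℂ f (ball 0 1))
    (hb : ∀ z ∈ ball (0 : ℂ) 1, ‖deriv f z‖ ∈ Icc m (m * Real.exp (Real.pi / 2))) :
    InjOn f (ball 0 1) := by
  intro a ha b hb' hab
  obtain ⟨r, hr, hr1⟩ := exists_between
    (max_lt (mem_ball_zero_iff.1 ha) (mem_ball_zero_iff.1 hb'))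
  have hr0 : 0 < r := (norm_nonneg a).trans_lt ((le_max_left _ _).trans_lt hr)
  have hrC : (r : ℂ) ≠ 0 := ofReal_ne_zero.2 hr0.ne'
  have hscale : ∀ z : ℂ, ‖(r : ℂ) * z‖ = r * ‖z‖ := fun z => by
    rw [norm_mul, norm_real, Real.norm_of_nonneg hr0.le]
  have hmem : ∀ z ∈ ball (0 : ℂ) r⁻¹, (r : ℂ) * z ∈ ball (0 : ℂ) 1 := by
    intro z hz
    rw [mem_ball_zero_iff, hscale]
    simpa [hr0.ne'] using mul_lt_mul_of_pos_left (mem_ball_zero_iff.1 hz) hr0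
  have hρ : 1 < r⁻¹ := (one_lt_inv₀ hr0).2 hr1
  have hsub : closedBall (0 : ℂ) 1 ⊆ ball 0 r⁻¹ := closedBall_subset_ball hρ
  have hd : ∀ g : ℂ → ℂ, DifferentiableOn ℂ g (ball 0 1) → ∀ z ∈ ball (0 : ℂ) r⁻¹,
      HasDerivAt (fun z => g (r * z)) (deriv g (r * z) * (r * 1)) z := fun g hg z hz =>
    (hg.differentiableAt (isOpen_ball.mem_nhds (hmem z hz))).hasDerivAt.comp z
      ((hasDerivAt_id z).const_mul (r : ℂ))
  have key := injOn_closedBall_of_one_sub_sq_mul_norm_le hρ (hd f hf)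
    (f'' := fun z => deriv (deriv f) (r * z) * (r * 1) * (r * 1))
    (fun z hz => (hd _ (hf.deriv isOpen_ball) z hz).mul_const _)
    (fun z hz => mul_ne_zero (norm_pos_iff.1 (hm.trans_le (hb _ (hmem z (hsub hz))).1))
      (by simpa using hrC))
    (fun z hz => by
      have h1 := one_sub_sq_mul_norm_deriv_le_of_norm_mem_Icc hm (hf.deriv isOpen_ball) hb
        (hmem z (hsub (ball_subset_closedBall hz)))
      have hz1 := mem_ball_zero_iff.1 hz
      rw [hscale] at h1
      simp only [norm_mul, norm_real, mul_one, Real.norm_of_nonneg hr0.le]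
      have h2 : (1 - ‖z‖ ^ 2) * r ≤ 1 - (r * ‖z‖) ^ 2 := by
        have h3 : 0 ≤ (1 - ‖z‖ ^ 2) := by nlinarith [norm_nonneg z]
        have h4 : (r * ‖z‖) ^ 2 ≤ ‖z‖ ^ 2 := by
          rw [mul_pow]
          exact mul_le_of_le_one_left (by positivity) (pow_le_one₀ hr0.le hr1.le)
        nlinarith
      have h5 := mul_le_mul_of_nonneg_right h2 (norm_nonneg (deriv (deriv f) (r * z)))
      calc _ = ((1 - ‖z‖ ^ 2) * r * ‖deriv (deriv f) (r * z)‖) * r := by ring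
        _ ≤ _ := mul_le_mul_of_nonneg_right (h5.trans h1) hr0.le)
  have hdiv : ∀ z : ℂ, ‖z‖ < r → z / r ∈ closedBall (0 : ℂ) 1 := fun z hz => by
    rw [mem_closedBall_zero_iff, norm_div, norm_real, Real.norm_of_nonneg hr0.le]
    exact (div_le_one hr0).2 hz.le
  have h := key (hdiv a ((le_max_left _ _).trans_lt hr)) (hdiv b ((le_max_right _ _).trans_lt hr))
    (by simpa [mul_div_cancel₀ _ hrC] using hab)
  exact (div_left_inj' hrC).1 h

/-- **Univalency criterion / lower bound for the harmonic John constant.**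
If `f = h + conj g` is a sense-preserving harmonic mapping on the unit disk with
`M_f = sup Λ_f < ∞`, `m_f = inf λ_f > 0`, and `M_f / m_f ≤ e^{π/2}`, then `f` is
univalent (injective) on the disk.  In particular the harmonic John constant is
at least `e^{π/2}`. -/
theorem univalent_of_ratio_le_exp_pi_div_two
    (h g : ℂ → ℂ) (M m : ℝ)
    (hh : DifferentiableOn ℂ h (ball (0 : ℂ) 1))
    (hg : DifferentiableOn ℂ g (ball (0 : ℂ) 1))
    (hsp : ∀ z ∈ ball (0 : ℂ) 1, ‖deriv g z‖ < ‖deriv h z‖)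
    (hM : IsLUB ((fun z => ‖deriv h z‖ + ‖deriv g z‖) '' ball (0 : ℂ) 1) M)
    (hm : IsGLB ((fun z => |‖deriv h z‖ - ‖deriv g z‖|) '' ball (0 : ℂ) 1) m)
    (hm0 : 0 < m)
    (hratio : M / m ≤ Real.exp (Real.pi / 2)) :
    Set.InjOn (fun z => h z + conj (g z)) (ball (0 : ℂ) 1) := by
  have hlow : ∀ z ∈ ball (0 : ℂ) 1, m ≤ ‖deriv h z‖ - ‖deriv g z‖ := fun z hz => by
    have h1 := hm.1 (mem_image_of_mem _ hz)
    rwa [abs_of_pos (sub_pos.2 (hsp z hz))] at h1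
  have hupp : ∀ z ∈ ball (0 : ℂ) 1, ‖deriv h z‖ + ‖deriv g z‖ ≤ m * Real.exp (Real.pi / 2) :=
    fun z hz => (hM.1 (mem_image_of_mem _ hz)).trans ((div_le_iff₀' hm0).1 hratio)
  have hrot : ∀ u : ℂ, ‖u‖ = 1 → InjOn (fun z => h z + u * g z) (ball (0 : ℂ) 1) := by
    intro u hu
    refine injOn_ball_of_norm_deriv_mem_Icc hm0 (hh.add (hg.const_mul u)) fun z hz => ?_
    have hd : deriv (fun z => h z + u * g z) z = deriv h z + u * deriv g z :=
      ((hh.differentiableAt (isOpen_ball.mem_nhds hz)).hasDerivAt.add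
        ((hg.differentiableAt (isOpen_ball.mem_nhds hz)).hasDerivAt.const_mul u)).deriv
    have hnorm : ‖u * deriv g z‖ = ‖deriv g z‖ := by rw [norm_mul, hu, one_mul]
    have h1 := norm_sub_le_norm_add (deriv h z) (u * deriv g z)
    have h2 := norm_add_le (deriv h z) (u * deriv g z)
    rw [hnorm] at h1 h2
    rw [hd]
    exact ⟨(hlow z hz).trans h1, h2.trans (hupp z hz)⟩
  intro z hz w hw hzw
  have hsum : (h z - h w) + conj (g z - g w) = 0 := by
    rw [map_sub]
    linear_combination hzw
  by_cases hG : g z - g w = 0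
  · exact hrot 1 norm_one hz hw (by
      rw [hG, map_zero, add_zero] at hsum
      linear_combination hsum + hG)
  · refine hrot (conj (g z - g w) / (g z - g w)) ?_ hz hw ?_
    · rw [norm_div, norm_conj, div_self (norm_ne_zero_iff.2 hG)]
    · have h1 : conj (g z - g w) / (g z - g w) * (g z - g w) = conj (g z - g w) :=
        div_mul_cancel₀ _ hG
      linear_combination hsum + h1
end

section
/- There exists a constant c₁ with 0 < c₁ < ∞ such that for every f = h + conj(g) ∈ S_H^0, every ξ ∈ ℂ with |ξ| = 1, and all 0 ≤ ρ ≤ r < 1, Λ_f(rξ) ≥ (1/2^{1+c₁}) · Λ_f(ρξ) · ((1 − r)/(1 − ρ))^{c₁ − 1}. -/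
open Complex Metric Set ComplexConjugate

/-- `f = h + conj g` belongs to the class `S_H^0` of sense-preserving univalent
harmonic mappings of the unit disk normalized by `h(0) = g(0) = 0`, `h'(0) = 1`,
`g'(0) = 0`. -/
structure IsSH0 (h g : ℂ → ℂ) : Prop where
  diff_h : DifferentiableOn ℂ h (ball (0 : ℂ) 1)
  diff_g : DifferentiableOn ℂ g (ball (0 : ℂ) 1)
  sense_preserving : ∀ z ∈ ball (0 : ℂ) 1, ‖deriv g z‖ < ‖deriv h z‖
  injOn : Set.InjOn (fun z => h z + conj (g z)) (ball (0 : ℂ) 1)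
  h_zero : h 0 = 0
  g_zero : g 0 = 0
  dh_zero : deriv h 0 = 1
  dg_zero : deriv g 0 = 0

/-- A harmonic map that is `C¹`-close to the exponential on a disk containing a full period
is not injective there. -/
theorem not_injOn_of_deriv_near_exp {H G H' G' : ℂ → ℂ}
    (hH : ∀ z ∈ ball (0 : ℂ) 7, HasDerivAt H (H' z) z)
    (hG : ∀ z ∈ ball (0 : ℂ) 7, HasDerivAt G (G' z) z)
    (hH' : ∀ z ∈ ball (0 : ℂ) 7, ‖H' z - exp z‖ ≤ 1 / 200)
    (hG' : ∀ z ∈ ball (0 : ℂ) 7, ‖G' z‖ ≤ 1 / 200) :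
    ¬ InjOn (fun z => H z + conj (G z)) (ball (0 : ℂ) 7) := by
  intro hinj
  set F : ℂ → ℂ := fun z => H z + conj (G z) with hF
  set P : ℂ := 2 * Real.pi * I with hP
  have hPnorm : ‖P‖ = 2 * Real.pi := by
    simp [hP, abs_of_pos Real.pi_pos]
  have hPlt : ‖P‖ < 63 / 10 := by
    rw [hPnorm]; linarith [Real.pi_lt_d2]
  have hPgt : 6 < ‖P‖ := by
    rw [hPnorm]; linarith [Real.pi_gt_three]
  have hsub : closedBall P (1 / 4) ⊆ ball (0 : ℂ) 7 := by
    intro z hz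
    rw [mem_closedBall, dist_eq_norm] at hz
    rw [mem_ball_zero_iff]
    have := norm_add_le (z - P) P
    rw [sub_add_cancel] at this
    linarith
  have hP7 : P ∈ ball (0 : ℂ) 7 := hsub (mem_closedBall_self (by norm_num))
  have h07 : (0 : ℂ) ∈ ball (0 : ℂ) 7 := mem_ball_self (by norm_num)
  have hGlip : ∀ x ∈ ball (0 : ℂ) 7, ∀ y ∈ ball (0 : ℂ) 7, ‖G x - G y‖ ≤ 1 / 200 * ‖x - y‖ :=
    fun x hx y hy => (convex_ball (0 : ℂ) 7).norm_image_sub_le_of_norm_hasDerivWithin_le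
      (fun z hz => (hG z hz).hasDerivWithinAt) hG' hy hx
  have happ : ApproximatesLinearOn F ((ContinuousLinearEquiv.refl ℝ ℂ : ℂ ≃L[ℝ] ℂ) : ℂ →L[ℝ] ℂ)
      (closedBall P (1 / 4)) (51 / 100) := by
    intro x hx y hy
    have hH1 : ‖(H x - x) - (H y - y)‖ ≤ 101 / 200 * ‖x - y‖ := by
      refine (convex_closedBall P (1 / 4)).norm_image_sub_le_of_norm_hasDerivWithin_le
        (f := fun z => H z - z) (f' := fun z => H' z - 1)
        (fun z hz => ((hH z (hsub hz)).sub (hasDerivAt_id z)).hasDerivWithinAt) ?_ hy hx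
      intro z hz
      have hz' : ‖z - P‖ ≤ 1 / 4 := by simpa [dist_eq_norm] using hz
      have he : exp z = exp (z - P) := by
        rw [exp_sub, hP, exp_two_pi_mul_I, div_one]
      have h1 := norm_exp_sub_one_le (x := z - P) (by linarith)
      rw [← he] at h1
      have h2 := norm_add_le (H' z - exp z) (exp z - 1)
      rw [sub_add_sub_cancel] at h2
      linarith [hH' z (hsub hz)]
    have hG1 := hGlip x (hsub hx) y (hsub hy)
    have heq : F x - F y - ((ContinuousLinearEquiv.refl ℝ ℂ : ℂ ≃L[ℝ] ℂ) : ℂ →L[ℝ] ℂ) (x - y) =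
        ((H x - x) - (H y - y)) + conj (G x - G y) := by
      simp [hF]; ring
    rw [heq]
    refine (norm_add_le _ _).trans ?_
    rw [RCLike.norm_conj]
    push_cast
    linarith
  have hsurj := happ.surjOn_closedBall_of_nonlinearRightInverse
    (ContinuousLinearEquiv.refl ℝ ℂ).toNonlinearRightInverse (b := P) (ε := 1 / 4)
    (by norm_num) subset_rfl
  have hone : ((ContinuousLinearEquiv.refl ℝ ℂ).toNonlinearRightInverse.nnnorm : ℝ) = 1 := by
    change ‖(((ContinuousLinearEquiv.refl ℝ ℂ).symm : ℂ ≃L[ℝ] ℂ) : ℂ →L[ℝ] ℂ)‖ = 1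
    exact ContinuousLinearMap.norm_id
  have hclose : F 0 ∈ closedBall (F P) ((((ContinuousLinearEquiv.refl ℝ
      ℂ).toNonlinearRightInverse.nnnorm : ℝ)⁻¹ - ((51 / 100 : NNReal) : ℝ)) * (1 / 4)) := by
    rw [hone, mem_closedBall, dist_eq_norm]
    have hH1 : ‖(H 0 - exp 0) - (H P - exp P)‖ ≤ 1 / 200 * ‖0 - P‖ :=
      (convex_ball (0 : ℂ) 7).norm_image_sub_le_of_norm_hasDerivWithin_le
        (f := fun z => H z - exp z) (f' := fun z => H' z - exp z)
        (fun z hz => ((hH z hz).sub (hasDerivAt_exp z)).hasDerivWithinAt) hH' hP7 h07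
    have hG1 := hGlip 0 h07 P hP7
    have heP : exp P = 1 := by rw [hP, exp_two_pi_mul_I]
    have heq : F 0 - F P = ((H 0 - exp 0) - (H P - exp P)) + conj (G 0 - G P) := by
      simp [hF, heP]; ring
    rw [heq]
    refine (norm_add_le _ _).trans ?_
    rw [RCLike.norm_conj]
    rw [zero_sub, norm_neg] at hH1 hG1
    push_cast
    linarith
  obtain ⟨z, hz, hFz⟩ := hsurj hclose
  have hz0 : z = 0 := hinj (hsub hz) h07 hFz
  rw [hz0, mem_closedBall, dist_eq_norm, zero_sub, norm_neg] at hz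
  linarith

/-- The pseudo-hyperbolic expression is bounded by one on the unit disk. -/
theorem norm_sub_le_norm_one_sub_conj_mul {a b : ℂ} (ha : ‖a‖ ≤ 1) (hb : ‖b‖ ≤ 1) :
    ‖a - b‖ ≤ ‖1 - conj b * a‖ := by
  have h1 : normSq a ≤ 1 := by rw [normSq_eq_norm_sq]; nlinarith [norm_nonneg a]
  have h2 : normSq b ≤ 1 := by rw [normSq_eq_norm_sq]; nlinarith [norm_nonneg b]
  rw [← sq_le_sq₀ (norm_nonneg _) (norm_nonneg _), ← normSq_eq_norm_sq, ← normSq_eq_norm_sq]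
  simp only [normSq_apply, sub_re, sub_im, mul_re, mul_im, conj_re, conj_im, one_re, one_im] at *
  nlinarith [mul_nonneg (sub_nonneg.2 h1) (sub_nonneg.2 h2)]

/-- **Schwarz–Pick** estimate, based at the center of a disk. -/
theorem norm_sub_le_mul_norm_one_sub_conj_mul {ω : ℂ → ℂ} {N : ℝ}
    (hω : DifferentiableOn ℂ ω (ball 0 N)) (hω1 : ∀ z ∈ ball (0 : ℂ) N, ‖ω z‖ < 1)
    {z : ℂ} (hz : z ∈ ball (0 : ℂ) N) :
    ‖ω z - ω 0‖ ≤ ‖z‖ / N * ‖1 - conj (ω 0) * ω z‖ := by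
  have hN : 0 < N := (norm_nonneg z).trans_lt (mem_ball_zero_iff.1 hz)
  have hb := hω1 0 (mem_ball_self hN)
  have hne : ∀ w ∈ ball (0 : ℂ) N, 1 - conj (ω 0) * ω w ≠ 0 := by
    intro w hw h0
    have : ‖conj (ω 0) * ω w‖ = 1 := by rw [← sub_eq_zero.1 h0]; simp
    rw [norm_mul, RCLike.norm_conj] at this
    nlinarith [hω1 w hw, norm_nonneg (ω w), norm_nonneg (ω 0)]
  have := dist_le_div_mul_dist_of_mapsTo_ball (f := fun w => (ω w - ω 0) / (1 - conj (ω 0) * ω w))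
    (R₂ := 1) ((hω.sub_const _).div ((hω.const_mul _).const_sub 1) hne) (by
      intro w hw
      rw [mem_closedBall, dist_eq_norm]
      simp only [sub_self, zero_div, sub_zero, norm_div]
      exact div_le_one_of_le₀ (norm_sub_le_norm_one_sub_conj_mul (hω1 w hw).le hb.le)
        (norm_nonneg _)) hz
  simp only [dist_eq_norm, sub_self, zero_div, sub_zero, norm_div] at this
  rw [div_le_iff₀ (norm_pos_iff.2 (hne z hz))] at this
  rwa [one_div_mul_eq_div] at this

/-- A sense-preserving harmonic map on a huge disk is not injective if its analytic part has
derivative `exp p`, where the derivative of `p` is bounded by `2` and equals `1` at the center. -/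
theorem not_injOn_of_norm_deriv_log_le {H G p q ω : ℂ → ℂ}
    (hH : ∀ z ∈ ball (0 : ℂ) (10 ^ 9), HasDerivAt H (exp (p z)) z)
    (hG : ∀ z ∈ ball (0 : ℂ) (10 ^ 9), HasDerivAt G (ω z * exp (p z)) z)
    (hp : ∀ z ∈ ball (0 : ℂ) (10 ^ 9), HasDerivAt p (q z) z)
    (hq : DifferentiableOn ℂ q (ball 0 (10 ^ 9)))
    (hω : DifferentiableOn ℂ ω (ball 0 (10 ^ 9)))
    (hω1 : ∀ z ∈ ball (0 : ℂ) (10 ^ 9), ‖ω z‖ < 1)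
    (hq2 : ∀ z ∈ ball (0 : ℂ) (10 ^ 9), ‖q z‖ ≤ 2) (hq0 : q 0 = 1) (hp0 : p 0 = 0) :
    ¬ InjOn (fun z => H z + conj (G z)) (ball (0 : ℂ) (10 ^ 9)) := by
  intro hinj
  have hsub : ball (0 : ℂ) 7 ⊆ ball 0 (10 ^ 9) := ball_subset_ball (by norm_num)
  have h0 : (0 : ℂ) ∈ ball (0 : ℂ) (10 ^ 9) := mem_ball_self (by norm_num)
  set b := ω 0 with hb
  have hb1 : ‖b‖ < 1 := hω1 0 h0
  set s : ℂ := 1 - conj b * b with hs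
  have hsnorm : s = ((1 - ‖b‖ ^ 2 : ℝ) : ℂ) := by
    rw [hs, ← normSq_eq_conj_mul_self, normSq_eq_norm_sq]; push_cast; ring
  have hs0 : s ≠ 0 := by
    rw [hsnorm]
    have : 0 < 1 - ‖b‖ ^ 2 := by nlinarith [norm_nonneg b]
    exact_mod_cast this.ne'
  have hsconj : conj s = s := by rw [hsnorm, conj_ofReal]
  set σ : ℂ → ℂ := fun z => (1 - conj b * ω z) / s with hσ
  have hpz : ∀ z ∈ ball (0 : ℂ) 7, ‖p z - z‖ ≤ 147 / 10 ^ 9 := by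
    intro z hz
    have hq1 : ∀ w ∈ ball (0 : ℂ) 7, ‖q w - 1‖ ≤ 21 / 10 ^ 9 := by
      intro w hw
      have := dist_le_div_mul_dist_of_mapsTo_ball (R₂ := 3) hq (by
        intro u hu
        rw [mem_closedBall, dist_eq_norm, hq0]
        refine (norm_sub_le _ _).trans ?_
        rw [norm_one]
        linarith [hq2 u hu]) (hsub hw)
      rw [dist_eq_norm, hq0, dist_zero_right] at this
      rw [mem_ball_zero_iff] at hw
      refine this.trans ?_
      rw [div_mul_eq_mul_div]
      gcongr
      linarith
    have := (convex_ball (0 : ℂ) 7).norm_image_sub_le_of_norm_hasDerivWithin_le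
      (f := fun z => p z - z) (f' := fun z => q z - 1)
      (fun w hw => ((hp w (hsub hw)).sub (hasDerivAt_id w)).hasDerivWithinAt) hq1
      (mem_ball_self (by norm_num)) hz
    rw [hp0, sub_zero, sub_zero, sub_zero] at this
    rw [mem_ball_zero_iff] at hz
    refine this.trans ?_
    linarith
  have hexp : ∀ z ∈ ball (0 : ℂ) 7, ‖exp z‖ ≤ 2187 := by
    intro z hz
    rw [mem_ball_zero_iff] at hz
    rw [norm_exp]
    calc Real.exp z.re ≤ Real.exp 7 := Real.exp_le_exp.2 ((re_le_norm z).trans hz.le)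
      _ = Real.exp 1 ^ 7 := by rw [← Real.exp_nat_mul]; norm_num
      _ ≤ 3 ^ 7 := by gcongr; exact Real.exp_one_lt_three.le
      _ = 2187 := by norm_num
  have hexpp : ∀ z ∈ ball (0 : ℂ) 7, ‖exp (p z) - exp z‖ ≤ 2187 * (294 / 10 ^ 9) := by
    intro z hz
    have heq : exp (p z) - exp z = exp z * (exp (p z - z) - 1) := by
      rw [mul_sub, ← exp_add]; simp
    have h1 := hpz z hz
    have h2 := norm_exp_sub_one_le (x := p z - z) (h1.trans (by norm_num))
    rw [heq, norm_mul]
    gcongr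
    · exact hexp z hz
    · linarith
  have hpick : ∀ z ∈ ball (0 : ℂ) 7, ‖(ω z - b) / s‖ ≤ 7 / 10 ^ 9 * ‖σ z‖ := by
    intro z hz
    have := norm_sub_le_mul_norm_one_sub_conj_mul hω hω1 (hsub hz)
    rw [mem_ball_zero_iff] at hz
    rw [hσ]
    simp only [norm_div]
    rw [← mul_div_assoc]
    gcongr
    refine this.trans ?_
    gcongr
  have hσ1 : ∀ z ∈ ball (0 : ℂ) 7, ‖σ z - 1‖ ≤ 14 / 10 ^ 9 := by
    intro z hz
    have heq : σ z - 1 = - (conj b * ((ω z - b) / s)) := by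
      simp only [hσ]; field_simp; rw [hs]; ring
    have h1 : ‖σ z - 1‖ ≤ 7 / 10 ^ 9 * ‖σ z‖ := by
      rw [heq, norm_neg, norm_mul, RCLike.norm_conj]
      have := hpick z hz
      nlinarith [norm_nonneg ((ω z - b) / s)]
    have h2 := norm_add_le (σ z - 1) 1
    rw [sub_add_cancel, norm_one] at h2
    linarith
  have hσ2 : ∀ z ∈ ball (0 : ℂ) 7, ‖σ z‖ ≤ 2 := by
    intro z hz
    have h2 := norm_add_le (σ z - 1) 1
    rw [sub_add_cancel, norm_one] at h2
    linarith [hσ1 z hz]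
  refine not_injOn_of_deriv_near_exp
    (H := fun z => (H z - conj b * G z) / s) (G := fun z => (G z - b * H z) / s)
    (H' := fun z => exp (p z) * σ z) (G' := fun z => exp (p z) * ((ω z - b) / s))
    ?_ ?_ ?_ ?_ ?_
  · intro z hz
    refine (((hH z (hsub hz)).sub ((hG z (hsub hz)).const_mul (conj b))).div_const s).congr_deriv ?_
    simp only [hσ]; ring
  · intro z hz
    refine (((hG z (hsub hz)).sub ((hH z (hsub hz)).const_mul b)).div_const s).congr_deriv ?_
    ring
  · intro z hz
    have heq : exp (p z) * σ z - exp z = (exp (p z) - exp z) * σ z + exp z * (σ z - 1) := by ring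
    calc ‖exp (p z) * σ z - exp z‖
        ≤ ‖exp (p z) - exp z‖ * ‖σ z‖ + ‖exp z‖ * ‖σ z - 1‖ := by
          rw [heq, ← norm_mul, ← norm_mul]; exact norm_add_le _ _
      _ ≤ 2187 * (294 / 10 ^ 9) * 2 + 2187 * (14 / 10 ^ 9) := by
          gcongr
          · exact hexpp z hz
          · exact hσ2 z hz
          · exact hexp z hz
          · exact hσ1 z hz
      _ ≤ 1 / 200 := by norm_num
  · intro z hz
    have h1 : ‖exp (p z)‖ ≤ 2188 := by
      have h2 := norm_add_le (exp (p z) - exp z) (exp z)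
      rw [sub_add_cancel] at h2
      linarith [hexpp z hz, hexp z hz]
    calc ‖exp (p z) * ((ω z - b) / s)‖ = ‖exp (p z)‖ * ‖(ω z - b) / s‖ := norm_mul _ _
      _ ≤ 2188 * (7 / 10 ^ 9 * 2) := by
          gcongr
          refine (hpick z hz).trans ?_
          gcongr
          exact hσ2 z hz
      _ ≤ 1 / 200 := by norm_num
  · intro x hx y hy hxy
    refine hinj (hsub hx) (hsub hy) ?_
    simp only [map_div₀, map_sub, map_mul, hsconj, ← add_div] at hxy
    rw [div_left_inj' hs0] at hxy
    set d : ℂ := (H x + conj (G x)) - (H y + conj (G y)) with hd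
    have hdeq : d = conj b * conj d := by
      simp only [hd, map_sub, map_add, conj_conj]
      linear_combination hxy
    have hdn : ‖d‖ = ‖b‖ * ‖d‖ := by
      have := congrArg norm hdeq
      rwa [norm_mul, RCLike.norm_conj, RCLike.norm_conj] at this
    have hd0 : ‖d‖ = 0 := by nlinarith [norm_nonneg d]
    exact sub_eq_zero.1 (norm_eq_zero.1 hd0)

/-- The pre-Schwarzian derivative `q` of the analytic part of a sense-preserving univalent harmonic
map of the unit disk is bounded by a universal multiple of the reciprocal distance to the
boundary. -/
theorem one_sub_norm_mul_norm_le_of_injOn {h g p q ω : ℂ → ℂ}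
    (hh : ∀ z ∈ ball (0 : ℂ) 1, HasDerivAt h (exp (p z)) z)
    (hg : ∀ z ∈ ball (0 : ℂ) 1, HasDerivAt g (ω z * exp (p z)) z)
    (hp : ∀ z ∈ ball (0 : ℂ) 1, HasDerivAt p (q z) z)
    (hq : DifferentiableOn ℂ q (ball 0 1))
    (hω : DifferentiableOn ℂ ω (ball 0 1))
    (hω1 : ∀ z ∈ ball (0 : ℂ) 1, ‖ω z‖ < 1)
    (hinj : InjOn (fun z => h z + conj (g z)) (ball (0 : ℂ) 1))
    {z : ℂ} (hz : z ∈ ball (0 : ℂ) 1) :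
    (1 - ‖z‖) * ‖q z‖ ≤ 4 * 10 ^ 9 := by
  by_contra! hcon
  obtain ⟨R, hR1, hRz, hR⟩ : ∃ R : ℝ, R < 1 ∧ ‖z‖ < R ∧ 2 * 10 ^ 9 < (R - ‖z‖) * ‖q z‖ := by
    rw [mem_ball_zero_iff] at hz
    exact ⟨(1 + ‖z‖) / 2, by linarith, by linarith, by linarith⟩
  have hsubR : closedBall (0 : ℂ) R ⊆ ball 0 1 := closedBall_subset_ball hR1
  obtain ⟨z₀, hz₀, hmax⟩ := (isCompact_closedBall (0 : ℂ) R).exists_isMaxOn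
    (f := fun w => (R - ‖w‖) * ‖q w‖) ⟨z, by simpa using hRz.le⟩
    ((continuousOn_const.sub continuous_norm.continuousOn).mul
      (hq.continuousOn.mono hsubR).norm)
  have hB : 2 * 10 ^ 9 < (R - ‖z₀‖) * ‖q z₀‖ :=
    hR.trans_le (hmax (show z ∈ closedBall (0 : ℂ) R by simpa using hRz.le))
  rw [mem_closedBall_zero_iff] at hz₀
  set c := q z₀ with hc
  have hcpos : 0 < ‖c‖ := by
    by_contra! h0
    nlinarith [norm_nonneg c]
  have hc0 : c ≠ 0 := norm_pos_iff.1 hcpos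
  set T : ℂ → ℂ := fun ζ => z₀ + ζ / c with hT
  have hTnorm : ∀ ζ ∈ ball (0 : ℂ) (10 ^ 9), ‖T ζ‖ < (R + ‖z₀‖) / 2 := by
    intro ζ hζ
    rw [mem_ball_zero_iff] at hζ
    have h1 : ‖ζ / c‖ < (R - ‖z₀‖) / 2 := by
      rw [norm_div, div_lt_iff₀ hcpos]; linarith
    linarith [norm_add_le z₀ (ζ / c)]
  have hTmem : ∀ ζ ∈ ball (0 : ℂ) (10 ^ 9), T ζ ∈ ball (0 : ℂ) 1 := by
    intro ζ hζ
    rw [mem_ball_zero_iff]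
    linarith [hTnorm ζ hζ]
  have hTd : ∀ ζ, HasDerivAt T (1 / c) ζ := fun ζ => by
    simpa [hT] using ((hasDerivAt_id ζ).div_const c).const_add z₀
  have hTdiff : DifferentiableOn ℂ T (ball 0 (10 ^ 9)) :=
    fun ζ _ => (hTd ζ).differentiableAt.differentiableWithinAt
  set k : ℂ := c * exp (- p z₀) with hk
  have hk0 : k ≠ 0 := mul_ne_zero hc0 (exp_ne_zero _)
  have hexpeq : ∀ ζ, exp (p (T ζ) - p z₀) = k * (exp (p (T ζ)) * (1 / c)) := by
    intro ζ
    rw [hk, sub_eq_add_neg, exp_add]; field_simp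
  refine not_injOn_of_norm_deriv_log_le (H := fun ζ => k * h (T ζ))
    (G := fun ζ => conj k * g (T ζ)) (p := fun ζ => p (T ζ) - p z₀)
    (q := fun ζ => q (T ζ) * (1 / c)) (ω := fun ζ => conj k / k * ω (T ζ))
    ?_ ?_ ?_ ?_ ?_ ?_ ?_ ?_ ?_ ?_
  · intro ζ hζ
    rw [hexpeq]
    exact ((hh _ (hTmem ζ hζ)).comp ζ (hTd ζ)).const_mul k
  · intro ζ hζ
    refine (((hg _ (hTmem ζ hζ)).comp ζ (hTd ζ)).const_mul (conj k)).congr_deriv ?_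
    rw [hexpeq]; field_simp
  · intro ζ hζ
    exact ((hp _ (hTmem ζ hζ)).comp ζ (hTd ζ)).sub_const _
  · exact (hq.comp hTdiff hTmem).mul_const _
  · exact (hω.comp hTdiff hTmem).const_mul _
  · intro ζ hζ
    rw [norm_mul, norm_div, RCLike.norm_conj, div_self (norm_ne_zero_iff.2 hk0), one_mul]
    exact hω1 _ (hTmem ζ hζ)
  · intro ζ hζ
    have h1 := hTnorm ζ hζ
    have h2 : (R - ‖T ζ‖) * ‖q (T ζ)‖ ≤ (R - ‖z₀‖) * ‖c‖ :=
      hmax (show T ζ ∈ closedBall (0 : ℂ) R by rw [mem_closedBall_zero_iff]; linarith)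
    have hpos : 0 < R - ‖z₀‖ := by
      by_contra! h0
      nlinarith
    rw [norm_mul, norm_div, norm_one, mul_one_div, div_le_iff₀ hcpos]
    have h3 : (R - ‖z₀‖) / 2 * ‖q (T ζ)‖ ≤ (R - ‖T ζ‖) * ‖q (T ζ)‖ := by
      gcongr; linarith
    nlinarith
  · simp [hT, ← hc, hc0]
  · simp [hT]
  · intro x hx y hy hxy
    simp only [map_mul, conj_conj, ← mul_add] at hxy
    have h1 := hinj (hTmem x hx) (hTmem y hy) (mul_left_cancel₀ hk0 hxy)
    simp only [hT] at h1
    exact (div_left_inj' hc0).1 (add_left_cancel h1)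

/-- A nonvanishing derivative of a holomorphic function on a disk is the exponential of a
holomorphic function. -/
theorem exists_deriv_eq_exp {h : ℂ → ℂ} (hh : DifferentiableOn ℂ h (ball 0 1))
    (hne : ∀ z ∈ ball (0 : ℂ) 1, deriv h z ≠ 0) :
    ∃ p q : ℂ → ℂ, DifferentiableOn ℂ q (ball 0 1) ∧
      (∀ z ∈ ball (0 : ℂ) 1, HasDerivAt p (q z) z) ∧
      ∀ z ∈ ball (0 : ℂ) 1, deriv h z = exp (p z) := by
  have hd : DifferentiableOn ℂ (deriv h) (ball 0 1) := hh.deriv isOpen_ball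
  have hq : DifferentiableOn ℂ (fun z => deriv (deriv h) z / deriv h z) (ball 0 1) :=
    (hd.deriv isOpen_ball).div hd hne
  have h0 : (0 : ℂ) ∈ ball (0 : ℂ) 1 := mem_ball_self one_pos
  obtain ⟨p, hp0, hp⟩ := hq.isExactOn_ball.with_val_at 0 (log (deriv h 0))
  refine ⟨p, _, hq, hp, fun z hz => ?_⟩
  have hder : ∀ w ∈ ball (0 : ℂ) 1, HasDerivAt (fun w => deriv h w * exp (- p w)) 0 w := by
    intro w hw
    have hdw := (hd.differentiableAt (isOpen_ball.mem_nhds hw)).hasDerivAt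
    refine (hdw.mul (hp w hw).neg.cexp).congr_deriv ?_
    have := hne w hw
    field_simp
    ring
  have hconst := (convex_ball (0 : ℂ) 1).norm_image_sub_le_of_norm_hasDerivWithin_le (C := 0)
    (fun w hw => (hder w hw).hasDerivWithinAt) (fun w _ => by simp) h0 hz
  rw [zero_mul, norm_le_zero_iff, sub_eq_zero, hp0, exp_neg, exp_neg, exp_log (hne 0 h0),
    mul_inv_cancel₀ (hne 0 h0)] at hconst
  rw [← div_eq_mul_inv, div_eq_one_iff_eq (exp_ne_zero _)] at hconst
  exact hconst

/-- Integrated form of `(1 - ‖z‖) * ‖q z‖ ≤ C`, for `q` the derivative of `p`, along a radius. -/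
theorem mul_log_le_re_sub_re {p q : ℂ → ℂ} {C : ℝ}
    (hp : ∀ z ∈ ball (0 : ℂ) 1, HasDerivAt p (q z) z)
    (hq : ∀ z ∈ ball (0 : ℂ) 1, (1 - ‖z‖) * ‖q z‖ ≤ C)
    {ξ : ℂ} (hξ : ‖ξ‖ = 1) {ρ r : ℝ} (hρ : 0 ≤ ρ) (hρr : ρ ≤ r) (hr : r < 1) :
    C * (Real.log (1 - r) - Real.log (1 - ρ)) ≤ (p (r * ξ)).re - (p (ρ * ξ)).re := by
  have hnorm : ∀ t ∈ Icc ρ r, ‖(t : ℂ) * ξ‖ = t := by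
    intro t ht
    rw [norm_mul, hξ, mul_one, norm_real, Real.norm_eq_abs, abs_of_nonneg (hρ.trans ht.1)]
  have hder : ∀ t ∈ Icc ρ r, HasDerivAt (fun t : ℝ => (p (t * ξ)).re - C * Real.log (1 - t))
      ((q (t * ξ) * ξ).re - C * (-1 / (1 - t))) t := by
    intro t ht
    have hmem : (t : ℂ) * ξ ∈ ball (0 : ℂ) 1 := by
      rw [mem_ball_zero_iff, hnorm t ht]; exact ht.2.trans_lt hr
    have h1 : HasDerivAt (fun w : ℂ => p (w * ξ)) (q (t * ξ) * ξ) (t : ℂ) := by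
      refine ((hp _ hmem).comp (t : ℂ) ((hasDerivAt_id (t : ℂ)).mul_const ξ)).congr_deriv ?_
      rw [one_mul]
    have ht1 : 1 - t ≠ 0 := by linarith [ht.2]
    have h2 : HasDerivAt (fun t : ℝ => 1 - t) (-1) t := by
      simpa using (hasDerivAt_id t).const_sub 1
    exact h1.real_of_complex.sub ((h2.log ht1).const_mul C)
  have hmono : MonotoneOn (fun t : ℝ => (p (t * ξ)).re - C * Real.log (1 - t)) (Icc ρ r) := by
    refine monotoneOn_of_hasDerivWithinAt_nonneg (convex_Icc ρ r)
      (fun t ht => (hder t ht).continuousAt.continuousWithinAt)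
      (fun t ht => (hder t (interior_subset ht)).hasDerivWithinAt) ?_
    intro t ht
    have ht' := interior_subset ht
    have hmem : (t : ℂ) * ξ ∈ ball (0 : ℂ) 1 := by
      rw [mem_ball_zero_iff, hnorm t ht']; exact ht'.2.trans_lt hr
    have h1 := hq _ hmem
    rw [hnorm t ht'] at h1
    have h2 : - ‖q (t * ξ)‖ ≤ (q (t * ξ) * ξ).re := by
      have := (abs_le.1 (abs_re_le_norm (q (t * ξ) * ξ))).1
      rwa [norm_mul, hξ, mul_one] at this
    have ht1 : 0 < 1 - t := by linarith [ht'.2]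
    have h3 : ‖q (t * ξ)‖ ≤ C / (1 - t) := by rw [le_div_iff₀ ht1]; linarith
    have h4 : C * (-1 / (1 - t)) = - (C / (1 - t)) := by ring
    rw [h4]; linarith
  have := hmono (left_mem_Icc.2 hρr) (right_mem_Icc.2 hρr) hρr
  simp only at this
  linarith

/-- There exists a finite constant `c₁ > 0` such that for every `f = h + conj g ∈ S_H^0`,
every `ξ` on the unit circle and all `0 ≤ ρ ≤ r < 1`,
`Λ_f(rξ) ≥ (1/2^{1+c₁}) · Λ_f(ρξ) · ((1-r)/(1-ρ))^{c₁-1}`. -/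
theorem lambda_lower_bound_SH0 :
    ∃ c₁ : ℝ, 0 < c₁ ∧
      ∀ h g : ℂ → ℂ, IsSH0 h g →
        ∀ ξ : ℂ, ‖ξ‖ = 1 → ∀ ρ r : ℝ, 0 ≤ ρ → ρ ≤ r → r < 1 →
          ‖deriv h ((r : ℂ) * ξ)‖ + ‖deriv g ((r : ℂ) * ξ)‖ ≥
            (1 / 2 ^ (1 + c₁)) * (‖deriv h ((ρ : ℂ) * ξ)‖ + ‖deriv g ((ρ : ℂ) * ξ)‖) *
              ((1 - r) / (1 - ρ)) ^ (c₁ - 1) := by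
  refine ⟨4 * 10 ^ 9 + 1, by norm_num, fun h g hf ξ hξ ρ r hρ hρr hr => ?_⟩
  have hne : ∀ z ∈ ball (0 : ℂ) 1, deriv h z ≠ 0 := fun z hz =>
    norm_pos_iff.1 ((norm_nonneg _).trans_lt (hf.sense_preserving z hz))
  obtain ⟨p, q, hq, hp, hhp⟩ := exists_deriv_eq_exp hf.diff_h hne
  have hbound : ∀ z ∈ ball (0 : ℂ) 1, (1 - ‖z‖) * ‖q z‖ ≤ 4 * 10 ^ 9 := fun z hz =>
    one_sub_norm_mul_norm_le_of_injOn (h := h) (g := g) (p := p)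
      (ω := fun w => deriv g w / deriv h w)
      (fun w hw => hhp w hw ▸ (hf.diff_h.differentiableAt (isOpen_ball.mem_nhds hw)).hasDerivAt)
      (fun w hw => by
        rw [← hhp w hw, div_mul_cancel₀ _ (hne w hw)]
        exact (hf.diff_g.differentiableAt (isOpen_ball.mem_nhds hw)).hasDerivAt)
      hp hq ((hf.diff_g.deriv isOpen_ball).div (hf.diff_h.deriv isOpen_ball) hne)
      (fun w hw => by
        rw [norm_div, div_lt_one (norm_pos_iff.2 (hne w hw))]
        exact hf.sense_preserving w hw)
      hf.injOn hz
  have hlog := mul_log_le_re_sub_re hp hbound hξ hρ hρr hr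
  have hmem : ∀ t : ℝ, 0 ≤ t → t < 1 → (t : ℂ) * ξ ∈ ball (0 : ℂ) 1 := fun t h0 h1 => by
    rwa [mem_ball_zero_iff, norm_mul, hξ, mul_one, norm_real, Real.norm_eq_abs, abs_of_nonneg h0]
  have hr0 : 0 < 1 - r := by linarith
  have hρ0 : 0 < 1 - ρ := by linarith
  have hmemρ := hmem ρ hρ (by linarith)
  have hmemr := hmem r (hρ.trans hρr) hr
  have hlower : ‖deriv h (ρ * ξ)‖ * ((1 - r) / (1 - ρ)) ^ ((4 * 10 ^ 9 + 1 : ℝ) - 1) ≤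
      ‖deriv h (r * ξ)‖ := by
    rw [hhp _ hmemρ, hhp _ hmemr, norm_exp, norm_exp, Real.rpow_def_of_pos (by positivity),
      Real.log_div hr0.ne' hρ0.ne', ← Real.exp_add, Real.exp_le_exp]
    linarith
  have hsp := hf.sense_preserving _ hmemρ
  have hpow : (1 : ℝ) / 2 ^ (1 + (4 * 10 ^ 9 + 1) : ℝ) ≤ 1 / 2 := by
    have : (2 : ℝ) ^ (1 : ℝ) ≤ 2 ^ (1 + (4 * 10 ^ 9 + 1) : ℝ) :=
      Real.rpow_le_rpow_of_exponent_le one_le_two (by norm_num)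
    rw [Real.rpow_one] at this
    gcongr
  calc (1 : ℝ) / 2 ^ (1 + (4 * 10 ^ 9 + 1) : ℝ) * (‖deriv h (ρ * ξ)‖ + ‖deriv g (ρ * ξ)‖) *
        ((1 - r) / (1 - ρ)) ^ ((4 * 10 ^ 9 + 1 : ℝ) - 1)
      ≤ 1 / 2 * (2 * ‖deriv h (ρ * ξ)‖) * ((1 - r) / (1 - ρ)) ^ ((4 * 10 ^ 9 + 1 : ℝ) - 1) := by
        gcongr
        linarith
    _ = ‖deriv h (ρ * ξ)‖ * ((1 - r) / (1 - ρ)) ^ ((4 * 10 ^ 9 + 1 : ℝ) - 1) := by ring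
    _ ≤ ‖deriv h (r * ξ)‖ := hlower
    _ ≤ ‖deriv h (r * ξ)‖ + ‖deriv g (r * ξ)‖ := le_add_of_nonneg_right (norm_nonneg _)
end

section
/- Let f = h + conj(g) ∈ S_H^0, let μ ∈ 𝔻, and suppose c₁ > 0 is a constant such that for all ζ ∈ 𝔻, |(1/2)(1 − |ζ|²)(h''(ζ) + μ g''(ζ))/(h'(ζ) + μ g'(ζ)) − conj(ζ)| ≤ c₁. Then for every ξ ∈ ℂ with |ξ| = 1 and all 0 ≤ ρ ≤ r < 1, |h'(rξ) + μ g'(rξ)| ≥ |h'(ρξ) + μ g'(ρξ)| · ((1 − r)/(1 − ρ))^{c₁ − 1} · ((1 + ρ)/(1 + r))^{c₁ + 1}. -/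
open Complex Metric Set ComplexConjugate

/-- A lower bound `2 (t - c) / (1 - t ^ 2)` for the logarithmic derivative of `‖F‖` gives
a lower bound for the growth of `‖F‖` on `[0, 1)`. -/
theorem norm_ge_of_log_deriv_ge {F F' : ℝ → ℂ} {c : ℝ}
    (hF : ∀ t ∈ Ico (0 : ℝ) 1, HasDerivAt F (F' t) t)
    (hF0 : ∀ t ∈ Ico (0 : ℝ) 1, F t ≠ 0)
    (hre : ∀ t ∈ Ico (0 : ℝ) 1, 2 * (t - c) / (1 - t ^ 2) ≤ (F' t / F t).re)
    {ρ r : ℝ} (hρ : 0 ≤ ρ) (hρr : ρ ≤ r) (hr : r < 1) :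
    ‖F ρ‖ * ((1 - r) / (1 - ρ)) ^ (c - 1) * ((1 + ρ) / (1 + r)) ^ (c + 1) ≤ ‖F r‖ := by
  have hderiv : ∀ t ∈ Ico (0 : ℝ) 1, HasDerivAt
      (fun t => Real.log (‖F t‖ ^ 2) / 2 + (1 - c) * Real.log (1 - t)
        + (1 + c) * Real.log (1 + t))
      ((F' t / F t).re - 2 * (t - c) / (1 - t ^ 2)) t := by
    intro t ht
    have h1 : 1 - t ≠ 0 := by linarith [ht.2]
    have h2 : 1 + t ≠ 0 := by linarith [ht.1]
    have h3 : 1 - t ^ 2 ≠ 0 := by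
      rw [show 1 - t ^ 2 = (1 - t) * (1 + t) by ring]
      exact mul_ne_zero h1 h2
    have hn : ‖F t‖ ^ 2 ≠ 0 := pow_ne_zero 2 (norm_ne_zero_iff.2 (hF0 t ht))
    have hlog := ((hF t ht).norm_sq.log hn).div_const 2
    have hsub := ((((hasDerivAt_id t).const_sub 1).log h1).const_mul (1 - c))
    have hadd := ((((hasDerivAt_id t).const_add 1).log h2).const_mul (1 + c))
    refine ((hlog.add hsub).add hadd).congr_deriv ?_
    have hdiv : (F' t / F t).re = inner ℝ (F t) (F' t) / ‖F t‖ ^ 2 := by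
      rw [Complex.div_re, Complex.inner, ← Complex.normSq_eq_norm_sq]
      simp only [Complex.mul_re, Complex.conj_re, Complex.conj_im]
      ring
    rw [hdiv]
    simp only [id]
    field_simp
    ring
  have hmono : MonotoneOn
      (fun t => Real.log (‖F t‖ ^ 2) / 2 + (1 - c) * Real.log (1 - t)
        + (1 + c) * Real.log (1 + t)) (Ico (0 : ℝ) 1) := by
    refine monotoneOn_of_deriv_nonneg (convex_Ico 0 1)
      (fun t ht => (hderiv t ht).continuousAt.continuousWithinAt)
      (fun t ht => (hderiv t (interior_subset ht)).differentiableAt.differentiableWithinAt)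
      (fun t ht => ?_)
    rw [(hderiv t (interior_subset ht)).deriv]
    exact sub_nonneg.2 (hre t (interior_subset ht))
  have hρmem : ρ ∈ Ico (0 : ℝ) 1 := ⟨hρ, hρr.trans_lt hr⟩
  have hrmem : r ∈ Ico (0 : ℝ) 1 := ⟨hρ.trans hρr, hr⟩
  have hle := hmono hρmem hrmem hρr
  have hFρ : 0 < ‖F ρ‖ := norm_pos_iff.2 (hF0 ρ hρmem)
  have hFr : 0 < ‖F r‖ := norm_pos_iff.2 (hF0 r hrmem)
  have h1r : 0 < 1 - r := by linarith
  have h1ρ : 0 < 1 - ρ := by linarith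
  have h2r : 0 < 1 + r := by linarith
  have h2ρ : 0 < 1 + ρ := by linarith
  have hp : 0 < ((1 - r) / (1 - ρ)) ^ (c - 1) := Real.rpow_pos_of_pos (div_pos h1r h1ρ) _
  have hq : 0 < ((1 + ρ) / (1 + r)) ^ (c + 1) := Real.rpow_pos_of_pos (div_pos h2ρ h2r) _
  rw [← Real.log_le_log_iff (by positivity) hFr, Real.log_mul (by positivity) hq.ne',
    Real.log_mul hFρ.ne' hp.ne', Real.log_rpow (div_pos h1r h1ρ),
    Real.log_rpow (div_pos h2ρ h2r), Real.log_div h1r.ne' h1ρ.ne',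
    Real.log_div h2ρ.ne' h2r.ne']
  simp only [Real.log_pow, Nat.cast_ofNat] at hle
  linarith

/-- A function holomorphic on an open set has its second iterated derivative as the
derivative of its derivative there. -/
theorem hasDerivAt_deriv_of_differentiableOn {f : ℂ → ℂ} {s : Set ℂ}
    (hf : DifferentiableOn ℂ f s) (hs : IsOpen s) {z : ℂ} (hz : z ∈ s) :
    HasDerivAt (deriv f) (iteratedDeriv 2 f z) z := by
  rw [iteratedDeriv_succ, iteratedDeriv_one]
  exact ((hf.deriv hs).differentiableAt (hs.mem_nhds hz)).hasDerivAt

/-- If `|(1 - |ζ|²) Q / 2 - conj ζ| ≤ c` at `ζ = t ξ` with `|ξ| = 1`, then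
`Re (ξ Q) ≥ 2 (t - c) / (1 - t²)`. -/
theorem le_re_mul_of_norm_sub_conj_le {ξ Q : ℂ} {t c : ℝ} (hξ : ‖ξ‖ = 1)
    (ht : t ∈ Ico (0 : ℝ) 1)
    (hQ : ‖(1 / 2 : ℂ) * (1 - (t : ℂ) ^ 2) * Q - conj ((t : ℂ) * ξ)‖ ≤ c) :
    2 * (t - c) / (1 - t ^ 2) ≤ (Q * ξ).re := by
  have hpos : 0 < 1 - t ^ 2 := by nlinarith [ht.1, ht.2]
  have hξξ : conj ξ * ξ = 1 := by
    rw [Complex.conj_mul', hξ]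
    simp
  have hrot : ((1 / 2 : ℂ) * (1 - (t : ℂ) ^ 2) * Q - conj ((t : ℂ) * ξ)) * ξ
      = (((1 - t ^ 2) / 2 : ℝ) : ℂ) * (Q * ξ) - (t : ℂ) := by
    rw [map_mul, Complex.conj_ofReal]
    push_cast
    linear_combination (-(t : ℂ)) * hξξ
  have hnorm : ‖(((1 - t ^ 2) / 2 : ℝ) : ℂ) * (Q * ξ) - (t : ℂ)‖ ≤ c := by
    rwa [← hrot, norm_mul, hξ, mul_one]
  have hre := (abs_le.1 ((Complex.abs_re_le_norm _).trans hnorm)).1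
  rw [Complex.sub_re, Complex.re_ofReal_mul, Complex.ofReal_re] at hre
  rw [div_le_iff₀ hpos]
  linarith

/-- If `f = h + conj g ∈ S_H^0`, `μ ∈ 𝔻`, and
`|(1/2)(1-|ζ|²)(h''(ζ)+μg''(ζ))/(h'(ζ)+μg'(ζ)) - conj ζ| ≤ c₁` on the disk, then for
every `ξ` on the unit circle and all `0 ≤ ρ ≤ r < 1`,
`|h'(rξ)+μg'(rξ)| ≥ |h'(ρξ)+μg'(ρξ)| · ((1-r)/(1-ρ))^{c₁-1} · ((1+ρ)/(1+r))^{c₁+1}`. -/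
theorem deriv_growth_of_second_coeff_bound
    (h g : ℂ → ℂ) (hf : IsSH0 h g) (μ : ℂ) (hμ : ‖μ‖ < 1)
    (c₁ : ℝ) (hc₁ : 0 < c₁)
    (hbound : ∀ ζ ∈ ball (0 : ℂ) 1,
      ‖(1 / 2 : ℂ) * (1 - (‖ζ‖ : ℂ) ^ 2) *
            (iteratedDeriv 2 h ζ + μ * iteratedDeriv 2 g ζ) /
            (deriv h ζ + μ * deriv g ζ) -
          conj ζ‖ ≤ c₁) :
    ∀ ξ : ℂ, ‖ξ‖ = 1 → ∀ ρ r : ℝ, 0 ≤ ρ → ρ ≤ r → r < 1 →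
      ‖deriv h ((r : ℂ) * ξ) + μ * deriv g ((r : ℂ) * ξ)‖ ≥
        ‖deriv h ((ρ : ℂ) * ξ) + μ * deriv g ((ρ : ℂ) * ξ)‖ *
          ((1 - r) / (1 - ρ)) ^ (c₁ - 1) * ((1 + ρ) / (1 + r)) ^ (c₁ + 1) := by
  intro ξ hξ ρ r hρ hρr hr
  have hnorm : ∀ t ∈ Ico (0 : ℝ) 1, ‖(t : ℂ) * ξ‖ = t := fun t ht => by
    rw [norm_mul, hξ, mul_one, Complex.norm_of_nonneg ht.1]
  have hmem : ∀ t ∈ Ico (0 : ℝ) 1, (t : ℂ) * ξ ∈ ball (0 : ℂ) 1 := fun t ht => by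
    rw [mem_ball_zero_iff, hnorm t ht]
    exact ht.2
  refine norm_ge_of_log_deriv_ge
    (F := fun t : ℝ => deriv h ((t : ℂ) * ξ) + μ * deriv g ((t : ℂ) * ξ))
    (F' := fun t : ℝ => (iteratedDeriv 2 h ((t : ℂ) * ξ)
      + μ * iteratedDeriv 2 g ((t : ℂ) * ξ)) * ξ)
    (fun t ht => ?_) (fun t ht hzero => ?_) (fun t ht => ?_) hρ hρr hr
  · have hh := hasDerivAt_deriv_of_differentiableOn hf.diff_h isOpen_ball (hmem t ht)
    have hg := hasDerivAt_deriv_of_differentiableOn hf.diff_g isOpen_ball (hmem t ht)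
    have hline : HasDerivAt (fun s : ℝ => (s : ℂ) * ξ) ξ t := by
      simpa using (Complex.ofRealCLM.hasDerivAt (x := t)).mul_const ξ
    exact HasDerivAt.comp t (hh.add (hg.const_mul μ)) hline
  · have hlt := hf.sense_preserving _ (hmem t ht)
    have heq : ‖deriv h ((t : ℂ) * ξ)‖ = ‖μ‖ * ‖deriv g ((t : ℂ) * ξ)‖ := by
      rw [eq_neg_of_add_eq_zero_left hzero, norm_neg, norm_mul]
    nlinarith [norm_nonneg (deriv g ((t : ℂ) * ξ))]
  · have hb := hbound _ (hmem t ht)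
    rw [hnorm t ht, mul_div_assoc] at hb
    have hle := le_re_mul_of_norm_sub_conj_le hξ ht hb
    rwa [div_mul_eq_mul_div] at hle
end

section
/- Let 0 ≤ c < 1 and define f(z) = z + (c/2)·conj(z)² for z ∈ 𝔻. Then f is univalent on 𝔻 and f(𝔻) is a ((1+c)/(1−c))-linearly connected domain; in fact, for any two points w₁, w₂ ∈ 𝔻, the image under F(w) = w + (c/2)·conj(w)² of the line segment γ joining w₁ and w₂ satisfies ℓ(F(γ)) ≤ (1+c)|w₂ − w₁| and |F(w₂) − F(w₁)| ≥ (1−c)|w₂ − w₁|, hence ℓ(F(γ)) ≤ ((1+c)/(1−c))|F(w₂) − F(w₁)|. -/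
open Complex Metric Set ComplexConjugate

/-- A set `Ω ⊆ ℂ` is `M`-linearly connected if any two of its points can be joined by a
path in `Ω` of length at most `M` times the distance between them. -/
def LinearlyConnected (Ω : Set ℂ) (M : ℝ) : Prop :=
  ∀ z ∈ Ω, ∀ w ∈ Ω, ∃ γ : ℝ → ℂ,
    ContinuousOn γ (Set.Icc 0 1) ∧ γ 0 = z ∧ γ 1 = w ∧
    (∀ t ∈ Set.Icc (0 : ℝ) 1, γ t ∈ Ω) ∧
    eVariationOn γ (Set.Icc 0 1) ≤ ENNReal.ofReal (M * ‖z - w‖)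

/-- The difference quotient of the quadratic antiholomorphic term on the unit disk is bounded
by `c`. -/
theorem norm_shear_sub_le {c : ℝ} (hc0 : 0 ≤ c) {a b : ℂ} (ha : a ∈ ball (0 : ℂ) 1)
    (hb : b ∈ ball (0 : ℂ) 1) :
    ‖(c : ℂ) / 2 * (conj b) ^ 2 - (c : ℂ) / 2 * (conj a) ^ 2‖ ≤ c * ‖b - a‖ := by
  rw [mem_ball_zero_iff] at ha hb
  have h : (c : ℂ) / 2 * (conj b) ^ 2 - (c : ℂ) / 2 * (conj a) ^ 2
      = ((c / 2 : ℝ) : ℂ) * conj (b + a) * conj (b - a) := by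
    push_cast [map_add, map_sub]
    ring
  rw [h, norm_mul, norm_mul, Complex.norm_conj, Complex.norm_conj, Complex.norm_real,
    Real.norm_of_nonneg (by positivity)]
  have h2 : ‖b + a‖ ≤ 2 := (norm_add_le b a).trans (by linarith)
  have h3 : c / 2 * ‖b + a‖ ≤ c := by nlinarith
  exact mul_le_mul_of_nonneg_right h3 (norm_nonneg _)

theorem norm_affine_shear_sub_le {c : ℝ} (hc0 : 0 ≤ c) {a b : ℂ} (ha : a ∈ ball (0 : ℂ) 1)
    (hb : b ∈ ball (0 : ℂ) 1) :
    ‖(b + (c : ℂ) / 2 * (conj b) ^ 2) - (a + (c : ℂ) / 2 * (conj a) ^ 2)‖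
      ≤ (1 + c) * ‖b - a‖ := by
  rw [add_sub_add_comm]
  linarith [norm_add_le (b - a) ((c : ℂ) / 2 * (conj b) ^ 2 - (c : ℂ) / 2 * (conj a) ^ 2),
    norm_shear_sub_le hc0 ha hb]

theorem le_norm_affine_shear_sub {c : ℝ} (hc0 : 0 ≤ c) {a b : ℂ} (ha : a ∈ ball (0 : ℂ) 1)
    (hb : b ∈ ball (0 : ℂ) 1) :
    (1 - c) * ‖b - a‖
      ≤ ‖(b + (c : ℂ) / 2 * (conj b) ^ 2) - (a + (c : ℂ) / 2 * (conj a) ^ 2)‖ := by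
  rw [add_sub_add_comm]
  linarith [norm_sub_le_norm_add (b - a)
      ((c : ℂ) / 2 * (conj b) ^ 2 - (c : ℂ) / 2 * (conj a) ^ 2),
    norm_shear_sub_le hc0 ha hb]

theorem segment_mem_unit_ball {w₁ w₂ : ℂ} (h₁ : w₁ ∈ ball (0 : ℂ) 1) (h₂ : w₂ ∈ ball (0 : ℂ) 1)
    {t : ℝ} (ht : t ∈ Set.Icc (0 : ℝ) 1) : (1 - t) • w₁ + t • w₂ ∈ ball (0 : ℂ) 1 :=
  convex_ball (0 : ℂ) 1 h₁ h₂ (sub_nonneg.2 ht.2) ht.1 (by ring)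

theorem eVariationOn_affine_shear_segment_le {c : ℝ} (hc0 : 0 ≤ c) {w₁ w₂ : ℂ}
    (h₁ : w₁ ∈ ball (0 : ℂ) 1) (h₂ : w₂ ∈ ball (0 : ℂ) 1) :
    eVariationOn
        (fun t : ℝ =>
          (fun w : ℂ => w + (c : ℂ) / 2 * (conj w) ^ 2) ((1 - t) • w₁ + t • w₂))
        (Set.Icc 0 1) ≤ ENNReal.ofReal ((1 + c) * ‖w₂ - w₁‖) := by
  have hlip : LipschitzOnWith (Real.toNNReal ((1 + c) * ‖w₂ - w₁‖))
      (fun t : ℝ =>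
        (fun w : ℂ => w + (c : ℂ) / 2 * (conj w) ^ 2) ((1 - t) • w₁ + t • w₂))
      (Set.Icc 0 1) := by
    refine LipschitzOnWith.of_dist_le_mul fun t ht s hs => ?_
    rw [Real.coe_toNNReal _ (by positivity), dist_eq_norm, dist_eq_norm]
    refine (norm_affine_shear_sub_le hc0 (segment_mem_unit_ball h₁ h₂ hs)
      (segment_mem_unit_ball h₁ h₂ ht)).trans_eq ?_
    have h : (1 - t) • w₁ + t • w₂ - ((1 - s) • w₁ + s • w₂) = (t - s) • (w₂ - w₁) := by
      module
    rw [h, norm_smul]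
    ring
  have hid : eVariationOn (id : ℝ → ℝ) (Set.Icc 0 1) ≤ 1 := by simp
  calc _ ≤ ENNReal.ofReal ((1 + c) * ‖w₂ - w₁‖) * eVariationOn (id : ℝ → ℝ) (Set.Icc 0 1) :=
        hlip.comp_eVariationOn_le (mapsTo_id _)
    _ ≤ _ := mul_le_of_le_one_right' hid

/-- For `0 ≤ c < 1`, the harmonic mapping `F(w) = w + (c/2)·(conj w)²` is univalent on the
unit disk, its image is `((1+c)/(1-c))`-linearly connected, and for any `w₁, w₂` in the
disk the image of the segment joining them has length at most `(1+c)|w₂-w₁|`, while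
`|F(w₂) - F(w₁)| ≥ (1-c)|w₂-w₁|`. -/
theorem affine_shear_example_linearly_connected
    (c : ℝ) (hc0 : 0 ≤ c) (hc1 : c < 1) :
    Set.InjOn (fun w : ℂ => w + (c : ℂ) / 2 * (conj w) ^ 2) (ball (0 : ℂ) 1) ∧
    LinearlyConnected ((fun w : ℂ => w + (c : ℂ) / 2 * (conj w) ^ 2) '' ball (0 : ℂ) 1)
      ((1 + c) / (1 - c)) ∧
    ∀ w₁ ∈ ball (0 : ℂ) 1, ∀ w₂ ∈ ball (0 : ℂ) 1,
      eVariationOn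
          (fun t : ℝ =>
            (fun w : ℂ => w + (c : ℂ) / 2 * (conj w) ^ 2) ((1 - t) • w₁ + t • w₂))
          (Set.Icc 0 1) ≤ ENNReal.ofReal ((1 + c) * ‖w₂ - w₁‖) ∧
      (1 - c) * ‖w₂ - w₁‖ ≤
        ‖(w₂ + (c : ℂ) / 2 * (conj w₂) ^ 2) - (w₁ + (c : ℂ) / 2 * (conj w₁) ^ 2)‖ := by
  refine ⟨fun a ha b hb hab => ?_, ?_, fun w₁ h₁ w₂ h₂ =>
    ⟨eVariationOn_affine_shear_segment_le hc0 h₁ h₂, le_norm_affine_shear_sub hc0 h₁ h₂⟩⟩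
  · have h := le_norm_affine_shear_sub hc0 hb ha
    rw [sub_eq_zero.2 hab, norm_zero] at h
    have h0 : ‖a - b‖ ≤ 0 := nonpos_of_mul_nonpos_right h (sub_pos.2 hc1)
    exact sub_eq_zero.1 (norm_le_zero_iff.1 h0)
  · rintro _ ⟨a, ha, rfl⟩ _ ⟨b, hb, rfl⟩
    refine ⟨fun t : ℝ =>
      (fun w : ℂ => w + (c : ℂ) / 2 * (conj w) ^ 2) ((1 - t) • a + t • b),
      ?_, by simp, by simp, fun t ht => mem_image_of_mem _ (segment_mem_unit_ball ha hb ht),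
      (eVariationOn_affine_shear_segment_le hc0 ha hb).trans (ENNReal.ofReal_le_ofReal ?_)⟩
    · have hcont : Continuous fun w : ℂ => w + (c : ℂ) / 2 * (conj w) ^ 2 := by fun_prop
      exact (hcont.comp (by fun_prop)).continuousOn
    · have h := le_norm_affine_shear_sub hc0 hb ha
      rw [div_mul_eq_mul_div, le_div_iff₀ (sub_pos.2 hc1), norm_sub_rev b a]
      nlinarith
end

section
/- Let f = h + conj(g) be a sense-preserving univalent harmonic mapping of the unit disk 𝔻 such that Ω = f(𝔻) is an M-linearly connected domain, and suppose the dilatation ω = g'/h' satisfies |ω(z)| ≤ c for all z ∈ 𝔻, where 0 ≤ c < 1/(2M+1). Then for every θ ∈ [0, 2π), the analytic function T_θ = h + e^{iθ} g is univalent on 𝔻 and T_θ(𝔻) is an (M(1+c)/(1 − c(1+2M)))-linearly connected domain. -/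
open Complex Metric Set ComplexConjugate

open scoped NNReal ENNReal Topology

/-- A map that is locally `K`-Lipschitz along a curve increases its length at most `K`-fold. -/
theorem eVariationOn_comp_le_of_locally_lipschitz {E F : Type*} [PseudoEMetricSpace E]
    [PseudoEMetricSpace F] {φ : E → F} {γ : ℝ → E} {K : ℝ≥0} {a b : ℝ} (hab : a ≤ b)
    (hγ : ContinuousOn γ (Icc a b))
    (hφ : ∀ t ∈ Icc a b, ∃ U ∈ 𝓝 (γ t), LipschitzOnWith K φ U) :
    eVariationOn (φ ∘ γ) (Icc a b) ≤ K * eVariationOn γ (Icc a b) := by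
  choose! U hU hL using hφ
  obtain ⟨t, ht0, htm, ⟨m, hm⟩, htc⟩ := exists_monotone_Icc_subset_open_cover_Icc hab
    (c := fun i : Icc a b => (Icc a b).domRestrict γ ⁻¹' interior (U i))
    (fun i => isOpen_interior.preimage hγ.domRestrict)
    (fun x _ => mem_iUnion.2 ⟨x, mem_interior_iff_mem_nhds.2 (hU x x.2)⟩)
  have key : ∀ n, eVariationOn (φ ∘ γ) (Icc a (t n)) ≤ K * eVariationOn γ (Icc a (t n)) := by
    intro n
    induction n with
    | zero => simp [ht0, eVariationOn.subsingleton]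
    | succ n ih =>
      have h1 : a ≤ t n := (t n).2.1
      have h2 : (t n : ℝ) ≤ t (n + 1) := htm n.le_succ
      obtain ⟨i, hi⟩ := htc n
      have hmaps : MapsTo γ (Icc (t n : ℝ) (t (n + 1))) (U i) := fun x hx =>
        interior_subset (@hi ⟨x, h1.trans hx.1, hx.2.trans (t (n + 1)).2.2⟩ hx)
      have hstep : eVariationOn (φ ∘ γ) (Icc (t n) (t (n + 1))) ≤
          K * eVariationOn γ (Icc (t n) (t (n + 1))) :=
        (hL i i.2).comp_eVariationOn_le hmaps
      have e1 := eVariationOn.Icc_add_Icc (φ ∘ γ) (s := univ) h1 h2 (mem_univ _)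
      have e2 := eVariationOn.Icc_add_Icc γ (s := univ) h1 h2 (mem_univ _)
      simp only [univ_inter] at e1 e2
      rw [← e1, ← e2, mul_add]
      exact add_le_add ih hstep
  simpa [hm m le_rfl] using key m

/-- A map whose derivative has norm at most `K` along a rectifiable curve increases its length
at most `K`-fold. -/
theorem eVariationOn_comp_le_of_hasStrictFDerivAt {E F : Type*} [NormedAddCommGroup E]
    [NormedSpace ℝ E] [NormedAddCommGroup F] [NormedSpace ℝ F] {φ : E → F}
    {φ' : E → E →L[ℝ] F} {γ : ℝ → E} {K : ℝ≥0} {a b : ℝ} (hab : a ≤ b)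
    (hγ : ContinuousOn γ (Icc a b)) (hV : eVariationOn γ (Icc a b) ≠ ∞)
    (hφ : ∀ t ∈ Icc a b, HasStrictFDerivAt φ (φ' (γ t)) (γ t))
    (hK : ∀ t ∈ Icc a b, ‖φ' (γ t)‖₊ ≤ K) :
    eVariationOn (φ ∘ γ) (Icc a b) ≤ K * eVariationOn γ (Icc a b) := by
  have hlim : Filter.Tendsto (fun k : ℝ≥0 => (k : ℝ≥0∞) * eVariationOn γ (Icc a b)) (𝓝[>] K)
      (𝓝 (K * eVariationOn γ (Icc a b))) :=
    ENNReal.Tendsto.mul_const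
      ((ENNReal.continuous_coe.tendsto K).mono_left nhdsWithin_le_nhds) (Or.inr hV)
  refine ge_of_tendsto hlim ?_
  filter_upwards [self_mem_nhdsWithin] with k hk
  exact eVariationOn_comp_le_of_locally_lipschitz hab hγ fun t ht =>
    (hφ t ht).exists_lipschitzOnWith_of_nnnorm_lt k ((hK t ht).trans_lt hk)

/-- If `G` is differentiable, `f` is injective on the open set `s` and `‖G'(z) v‖ ≤ K ‖f'(z) v‖`
with `f'(z)` injective, then `G ∘ f⁻¹` is strictly differentiable with derivative of norm
at most `K`. -/
theorem exists_hasStrictFDerivAt_comp_invFunOn {E F : Type*} [NormedAddCommGroup E]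
    [NormedSpace ℝ E] [FiniteDimensional ℝ E] [NormedAddCommGroup F] [NormedSpace ℝ F]
    {f : E → E} {G : E → F} {s : Set E} {z : E} {f' : E →L[ℝ] E} {G' : E →L[ℝ] F} {K : ℝ≥0}
    (hs : s ∈ 𝓝 z) (hinj : InjOn f s) (hf : HasStrictFDerivAt f f' z)
    (hG : HasStrictFDerivAt G G' z) (hf' : Function.Injective f')
    (hK : ∀ v, ‖G' v‖ ≤ K * ‖f' v‖) :
    ∃ φ' : E →L[ℝ] F, HasStrictFDerivAt (G ∘ Function.invFunOn f s) φ' (f z) ∧ ‖φ'‖₊ ≤ K := by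
  let e : E ≃L[ℝ] E := (LinearEquiv.ofInjectiveEndo (f' : E →ₗ[ℝ] E) hf').toContinuousLinearEquiv
  have he : (e : E →L[ℝ] E) = f' := by ext v; rfl
  have hleft : LeftInvOn (Function.invFunOn f s) f s := hinj.leftInvOn_invFunOn
  have hinv : HasStrictFDerivAt (Function.invFunOn f s) (e.symm : E →L[ℝ] E) (f z) :=
    HasStrictFDerivAt.to_local_left_inverse (he ▸ hf)
      (Filter.eventually_of_mem hs fun x hx => hleft hx)
  rw [← hleft (mem_of_mem_nhds hs)] at hG
  refine ⟨G'.comp (e.symm : E →L[ℝ] E), hG.comp (f z) hinv, ?_⟩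
  refine ContinuousLinearMap.opNorm_le_bound _ K.2 fun v => ?_
  have hv : f' (e.symm v) = v := by rw [← he]; exact e.apply_symm_apply v
  simpa [hv] using hK (e.symm v)

/-- The map `G ∘ f⁻¹` multiplies the length of curves in the image of `f` by at
most `K`, provided `‖G'(z) v‖ ≤ K ‖f'(z) v‖`. -/
theorem eVariationOn_comp_invFunOn_le {E F : Type*} [NormedAddCommGroup E]
    [NormedSpace ℝ E] [FiniteDimensional ℝ E] [NormedAddCommGroup F] [NormedSpace ℝ F]
    {f : E → E} {G : E → F} {s : Set E} {f' : E → E →L[ℝ] E} {G' : E → E →L[ℝ] F} {K : ℝ≥0}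
    (hs : IsOpen s) (hinj : InjOn f s)
    (hf : ∀ z ∈ s, HasStrictFDerivAt f (f' z) z) (hG : ∀ z ∈ s, HasStrictFDerivAt G (G' z) z)
    (hf' : ∀ z ∈ s, Function.Injective (f' z)) (hK : ∀ z ∈ s, ∀ v, ‖G' z v‖ ≤ K * ‖f' z v‖)
    {γ : ℝ → E} {a b : ℝ} (hab : a ≤ b) (hγ : ContinuousOn γ (Icc a b))
    (hV : eVariationOn γ (Icc a b) ≠ ∞) (hγs : ∀ t ∈ Icc a b, γ t ∈ f '' s) :
    ContinuousOn (G ∘ Function.invFunOn f s ∘ γ) (Icc a b) ∧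
      eVariationOn (G ∘ Function.invFunOn f s ∘ γ) (Icc a b) ≤ K * eVariationOn γ (Icc a b) := by
  have hex : ∀ w ∈ f '' s, ∃ φ' : E →L[ℝ] F,
      HasStrictFDerivAt (G ∘ Function.invFunOn f s) φ' w ∧ ‖φ'‖₊ ≤ K := by
    rintro _ ⟨z, hz, rfl⟩
    exact exists_hasStrictFDerivAt_comp_invFunOn (hs.mem_nhds hz) hinj (hf z hz) (hG z hz)
      (hf' z hz) (hK z hz)
  choose! φ' hφ' hφK using hex
  exact ⟨fun t ht => (hφ' _ (hγs t ht)).continuousAt.comp_continuousWithinAt (hγ t ht),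
    eVariationOn_comp_le_of_hasStrictFDerivAt (φ := G ∘ Function.invFunOn f s) hab hγ hV
      (fun t ht => hφ' _ (hγs t ht)) (fun t ht => hφK _ (hγs t ht))⟩

/-- Let `f = h + conj g` be a sense-preserving univalent harmonic mapping of the disk
whose image is `M`-linearly connected and whose dilatation satisfies `|ω| ≤ c < 1/(2M+1)`.
Then for each `θ ∈ [0, 2π)` the analytic function `T_θ = h + e^{iθ} g` is univalent and
`T_θ(𝔻)` is `(M(1+c)/(1-c(1+2M)))`-linearly connected. -/
theorem shear_univalent_linearly_connected
    (h g : ℂ → ℂ) (M c : ℝ) (hM : 1 ≤ M)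
    (hh : DifferentiableOn ℂ h (ball (0 : ℂ) 1))
    (hg : DifferentiableOn ℂ g (ball (0 : ℂ) 1))
    (hsp : ∀ z ∈ ball (0 : ℂ) 1, ‖deriv g z‖ < ‖deriv h z‖)
    (hinj : Set.InjOn (fun z => h z + conj (g z)) (ball (0 : ℂ) 1))
    (hlin : LinearlyConnected ((fun z => h z + conj (g z)) '' ball (0 : ℂ) 1) M)
    (hc0 : 0 ≤ c) (hc : c < 1 / (2 * M + 1))
    (hω : ∀ z ∈ ball (0 : ℂ) 1, ‖deriv g z‖ ≤ c * ‖deriv h z‖) :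
    ∀ θ ∈ Ico (0 : ℝ) (2 * Real.pi),
      Set.InjOn (fun z => h z + Complex.exp (θ * Complex.I) * g z) (ball (0 : ℂ) 1) ∧
      LinearlyConnected
        ((fun z => h z + Complex.exp (θ * Complex.I) * g z) '' ball (0 : ℂ) 1)
        (M * (1 + c) / (1 - c * (1 + 2 * M))) := by
  intro θ _
  set f : ℂ → ℂ := fun z => h z + conj (g z) with hf_def
  set ε : ℂ := Complex.exp (θ * Complex.I)
  have hε : ‖ε‖ = 1 := Complex.norm_exp_ofReal_mul_I θ
  set T : ℂ → ℂ := fun z => h z + ε * g z with hT_def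
  have hc' : 0 < 1 - c * (1 + 2 * M) := by
    rw [lt_div_iff₀ (by linarith)] at hc
    linarith
  have hc1 : 0 < 1 - c := by nlinarith
  let Dh : ℂ → ℂ →L[ℝ] ℂ := fun z =>
    (ContinuousLinearMap.toSpanSingleton ℂ (deriv h z)).restrictScalars ℝ
  let Dg : ℂ → ℂ →L[ℝ] ℂ := fun z =>
    (ContinuousLinearMap.toSpanSingleton ℂ (deriv g z)).restrictScalars ℝ
  let Df : ℂ → ℂ →L[ℝ] ℂ := fun z => Dh z + (conjCLE : ℂ →L[ℝ] ℂ).comp (Dg z)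
  let DT : ℂ → ℂ →L[ℝ] ℂ := fun z => Dh z + ε • Dg z
  have hDh : ∀ z ∈ ball (0 : ℂ) 1, HasStrictFDerivAt h (Dh z) z := fun z hz =>
    (hh.analyticAt (isOpen_ball.mem_nhds hz)).hasStrictDerivAt.hasStrictFDerivAt.restrictScalars ℝ
  have hDg : ∀ z ∈ ball (0 : ℂ) 1, HasStrictFDerivAt g (Dg z) z := fun z hz =>
    (hg.analyticAt (isOpen_ball.mem_nhds hz)).hasStrictDerivAt.hasStrictFDerivAt.restrictScalars ℝ
  have hDf : ∀ z ∈ ball (0 : ℂ) 1, HasStrictFDerivAt f (Df z) z := fun z hz =>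
    (hDh z hz).add ((conjCLE : ℂ →L[ℝ] ℂ).hasStrictFDerivAt.comp z (hDg z hz))
  have hDT : ∀ z ∈ ball (0 : ℂ) 1, HasStrictFDerivAt T (DT z) z := fun z hz =>
    (hDh z hz).add ((hDg z hz).const_smul ε)
  have hDf_apply : ∀ z v, Df z v = v * deriv h z + conj (v * deriv g z) := fun z v => rfl
  have hDT_apply : ∀ z v, DT z v = v * deriv h z + ε * (v * deriv g z) := fun z v => rfl
  have hDg_apply : ∀ z v, Dg z v = v * deriv g z := fun z v => rfl
  have hg_le : ∀ z ∈ ball (0 : ℂ) 1, ∀ v : ℂ, ‖v * deriv g z‖ ≤ c * ‖v * deriv h z‖ := by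
    intro z hz v
    rw [norm_mul, norm_mul]
    nlinarith [mul_le_mul_of_nonneg_left (hω z hz) (norm_nonneg v)]
  have hDf_ge : ∀ z ∈ ball (0 : ℂ) 1, ∀ v, (1 - c) * ‖v * deriv h z‖ ≤ ‖Df z v‖ := by
    intro z hz v
    have h1 := norm_sub_le_norm_add (v * deriv h z) (conj (v * deriv g z))
    rw [RCLike.norm_conj] at h1
    rw [hDf_apply]
    linarith [hg_le z hz v]
  have hDf_inj : ∀ z ∈ ball (0 : ℂ) 1, Function.Injective (Df z) := by
    intro z hz
    refine (injective_iff_map_eq_zero (Df z)).2 fun v hv => ?_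
    have h1 := hDf_ge z hz v
    rw [hv, norm_zero] at h1
    have h2 : ‖v * deriv h z‖ ≤ 0 := by
      by_contra! hlt
      exact absurd h1 (not_le.2 (mul_pos hc1 hlt))
    have h3 : deriv h z ≠ 0 := norm_pos_iff.1 ((norm_nonneg _).trans_lt (hsp z hz))
    exact (mul_eq_zero.1 (norm_le_zero_iff.1 h2)).resolve_right h3
  let Kg : ℝ≥0 := ⟨c / (1 - c), by positivity⟩
  let KT : ℝ≥0 := ⟨(1 + c) / (1 - c), by positivity⟩
  have hKg : ∀ z ∈ ball (0 : ℂ) 1, ∀ v, ‖Dg z v‖ ≤ Kg * ‖Df z v‖ := by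
    intro z hz v
    change ‖Dg z v‖ ≤ c / (1 - c) * ‖Df z v‖
    rw [div_mul_eq_mul_div, le_div_iff₀ hc1, hDg_apply]
    nlinarith [hg_le z hz v, hDf_ge z hz v]
  have hKT : ∀ z ∈ ball (0 : ℂ) 1, ∀ v, ‖DT z v‖ ≤ KT * ‖Df z v‖ := by
    intro z hz v
    change ‖DT z v‖ ≤ (1 + c) / (1 - c) * ‖Df z v‖
    rw [div_mul_eq_mul_div, le_div_iff₀ hc1, hDT_apply]
    have h1 := norm_add_le (v * deriv h z) (ε * (v * deriv g z))
    rw [norm_mul ε, hε, one_mul] at h1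
    nlinarith [hg_le z hz v, hDf_ge z hz v]
  set ψ := Function.invFunOn f (ball (0 : ℂ) 1)
  have hleft : LeftInvOn ψ f (ball (0 : ℂ) 1) := hinj.leftInvOn_invFunOn
  have hg_dist : ∀ z ∈ ball (0 : ℂ) 1, ∀ w ∈ ball (0 : ℂ) 1,
      ‖g z - g w‖ ≤ c / (1 - c) * (M * ‖f z - f w‖) := by
    intro z hz w hw
    obtain ⟨γ, hγ, hγ0, hγ1, hγs, hγV⟩ := hlin _ (mem_image_of_mem f hz) _ (mem_image_of_mem f hw)
    have hV := (eVariationOn_comp_invFunOn_le isOpen_ball hinj hDf hDg hDf_inj hKg zero_le_one hγ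
      (ne_top_of_le_ne_top ENNReal.ofReal_ne_top hγV) hγs).2
    have hd := eVariationOn.edist_le (g ∘ ψ ∘ γ) (left_mem_Icc.2 zero_le_one)
      (right_mem_Icc.2 (zero_le_one (α := ℝ)))
    simp only [Function.comp_apply, hγ0, hγ1] at hd
    rw [hleft hz, hleft hw] at hd
    have hle := hd.trans (hV.trans (mul_le_mul_right hγV Kg))
    rw [show (Kg : ℝ≥0∞) = ENNReal.ofReal (c / (1 - c)) from
        (ENNReal.ofReal_eq_coe_nnreal _).symm, ← ENNReal.ofReal_mul (by positivity), edist_dist,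
      ENNReal.ofReal_le_ofReal_iff (by positivity), dist_eq_norm] at hle
    exact hle
  have hT_dist : ∀ z ∈ ball (0 : ℂ) 1, ∀ w ∈ ball (0 : ℂ) 1,
      (1 - c * (1 + 2 * M)) * ‖f z - f w‖ ≤ (1 - c) * ‖T z - T w‖ := by
    intro z hz w hw
    have h1 : f z - f w = (T z - T w) + (conj (g z - g w) - ε * (g z - g w)) := by
      simp only [hf_def, hT_def, map_sub]
      ring
    have h2 : ‖f z - f w‖ ≤ ‖T z - T w‖ + (‖g z - g w‖ + ‖g z - g w‖) := by
      rw [h1]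
      refine (norm_add_le _ _).trans (add_le_add le_rfl ((norm_sub_le _ _).trans ?_))
      rw [RCLike.norm_conj, norm_mul, hε, one_mul]
    have h3 := hg_dist z hz w hw
    rw [div_mul_eq_mul_div, le_div_iff₀ hc1] at h3
    nlinarith
  refine ⟨fun z hz w hw hzw => hinj hz hw ?_, ?_⟩
  · have h1 := hT_dist z hz w hw
    rw [show T z = T w from hzw, sub_self, norm_zero, mul_zero] at h1
    by_contra hne
    exact absurd h1 (not_le.2 (mul_pos hc' (norm_pos_iff.2 (sub_ne_zero.2 hne))))
  · rintro _ ⟨z, hz, rfl⟩ _ ⟨w, hw, rfl⟩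
    obtain ⟨γ, hγ, hγ0, hγ1, hγs, hγV⟩ := hlin _ (mem_image_of_mem f hz) _ (mem_image_of_mem f hw)
    obtain ⟨hcont, hV⟩ := eVariationOn_comp_invFunOn_le isOpen_ball hinj hDf hDT hDf_inj hKT
      zero_le_one hγ (ne_top_of_le_ne_top ENNReal.ofReal_ne_top hγV) hγs
    refine ⟨T ∘ ψ ∘ γ, hcont, ?_, ?_, fun t ht => ?_, ?_⟩
    · simp only [Function.comp_apply, hγ0]
      rw [hleft hz]
    · simp only [Function.comp_apply, hγ1]
      rw [hleft hw]
    · exact mem_image_of_mem T (Function.invFunOn_mem (hγs t ht))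
    · refine hV.trans ((mul_le_mul_right hγV KT).trans ?_)
      rw [show (KT : ℝ≥0∞) = ENNReal.ofReal ((1 + c) / (1 - c)) from
        (ENNReal.ofReal_eq_coe_nnreal _).symm, ← ENNReal.ofReal_mul (by positivity)]
      refine ENNReal.ofReal_le_ofReal ?_
      rw [div_mul_eq_mul_div, div_mul_eq_mul_div, div_le_div_iff₀ hc1 hc']
      have h1 := mul_le_mul_of_nonneg_left (hT_dist z hz w hw)
        (show 0 ≤ M * (1 + c) by positivity)
      linarith
end
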